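/- Let A ∈ M_n(ℂ) be unitarily irreducible and suppose its base polynomial is reducible: P_A = G·H in ℂ[x, y, t] where G and H are nonconstant polynomials with real coefficients and P_A ∈ ℂ[x, y, t] is the determinant of x·Re A + y·Im A + t·I_n with polynomial entries. Then there exist d with 1 ≤ d ≤ n−1 and matrices B ∈ M_d(ℂ) and C ∈ M_{n−d}(ℂ) such that the block-diagonal matrix A' = B ⊕ C ∈ M_n(ℂ) satisfies F_{A'} = F_A (for all real x, y, t) and W(A') = W(A). -/

import Mathlib

open Matrix Complex

noncomputable section

/-- The Hermitian part `Re A = (A + A*)/2` of a complex matrix. -/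
def reM {n : ℕ} (A : Matrix (Fin n) (Fin n) ℂ) : Matrix (Fin n) (Fin n) ℂ :=
  (2⁻¹ : ℂ) • (A + Aᴴ)

/-- The matrix `Im A = (A - A*)/(2i)`. -/
def imM {n : ℕ} (A : Matrix (Fin n) (Fin n) ℂ) : Matrix (Fin n) (Fin n) ℂ :=
  ((2 * Complex.I)⁻¹ : ℂ) • (A - Aᴴ)

/-- The base polynomial of `A`, evaluated at real `(x, y, t)`:
`F_A(x,y,t) = det(x·Re A + y·Im A + t·I)`. -/
def basePoly {n : ℕ} (A : Matrix (Fin n) (Fin n) ℂ) (x y t : ℝ) : ℂ :=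
  ((x : ℂ) • reM A + (y : ℂ) • imM A + (t : ℂ) • (1 : Matrix (Fin n) (Fin n) ℂ)).det

/-- The base polynomial of `A` as a polynomial in the three variables
`x = X 0`, `y = X 1`, `t = X 2`. -/
def basePolyMv {n : ℕ} (A : Matrix (Fin n) (Fin n) ℂ) : MvPolynomial (Fin 3) ℂ :=
  Matrix.det (Matrix.of fun i j =>
    MvPolynomial.C (reM A i j) * MvPolynomial.X 0 +
    MvPolynomial.C (imM A i j) * MvPolynomial.X 1 +
    MvPolynomial.C ((1 : Matrix (Fin n) (Fin n) ℂ) i j) * MvPolynomial.X 2)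

/-- The numerical range `W(A) = {⟨Ax, x⟩ : ‖x‖ = 1}` (here `⟨Ax, x⟩ = x* A x`). -/
def numRange {n : ℕ} (A : Matrix (Fin n) (Fin n) ℂ) : Set ℂ :=
  {z | ∃ x : Fin n → ℂ, star x ⬝ᵥ x = 1 ∧ star x ⬝ᵥ A.mulVec x = z}

/-- `A` is unitarily irreducible: no nontrivial proper subspace is invariant under
both `A` and `A*`. -/
def UnitarilyIrreducible {n : ℕ} (A : Matrix (Fin n) (Fin n) ℂ) : Prop :=
  ¬ ∃ L : Submodule ℂ (Fin n → ℂ), 0 < Module.finrank ℂ L ∧ Module.finrank ℂ L < n ∧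
      (∀ x ∈ L, A.mulVec x ∈ L) ∧ (∀ x ∈ L, Aᴴ.mulVec x ∈ L)


section

open Polynomial Filter
open scoped ComplexOrder

namespace HV

/-- coefficientwise conjugation -/
def cj : ℂ[X] →+* ℂ[X] := Polynomial.mapRingHom (starRingEnd ℂ)

/-- evaluation of a polynomial matrix -/
def ev {m n : Type*} (z : ℂ) (M : Matrix m n ℂ[X]) : Matrix m n ℂ := M.map (Polynomial.evalRingHom z)

/-- conjugate transpose of a polynomial matrix -/
def cT {m n : Type*} (M : Matrix m n ℂ[X]) : Matrix n m ℂ[X] := (M.map cj)ᵀ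

@[simp] lemma ev_apply {m n : Type*} (z : ℂ) (M : Matrix m n ℂ[X]) (i : m) (j : n) :
    ev z M i j = (M i j).eval z := rfl

@[simp] lemma cT_apply {m n : Type*} (M : Matrix m n ℂ[X]) (i : n) (j : m) :
    cT M i j = cj (M j i) := rfl

lemma ev_mul {m n k : Type*} [Fintype n] (z : ℂ) (M : Matrix m n ℂ[X]) (N : Matrix n k ℂ[X]) :
    ev z (M * N) = ev z M * ev z N := by
  unfold ev; exact Matrix.map_mul

lemma ev_one {n : Type*} [DecidableEq n] (z : ℂ) : ev z (1 : Matrix n n ℂ[X]) = 1 := by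
  unfold ev; simp

lemma ev_det {n : Type*} [Fintype n] [DecidableEq n] (z : ℂ) (M : Matrix n n ℂ[X]) :
    (ev z M).det = M.det.eval z := by
  have := RingHom.map_det (Polynomial.evalRingHom z) M
  simpa [ev] using this.symm

lemma ev_mulVec {m n : Type*} [Fintype n] (z : ℂ) (M : Matrix m n ℂ[X]) (v : n → ℂ[X]) :
    ev z M *ᵥ (fun i => (v i).eval z) = fun i => ((M *ᵥ v) i).eval z := by
  ext i
  simp [Matrix.mulVec, dotProduct, Polynomial.eval_finsetSum]

lemma cj_eval (z : ℂ) (f : ℂ[X]) : (cj f).eval z = starRingEnd ℂ (f.eval (starRingEnd ℂ z)) := by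
  unfold cj
  rw [Polynomial.coe_mapRingHom, Polynomial.eval_map, ← Polynomial.eval₂_at_apply]
  simp

lemma cj_eval_real (y : ℝ) (f : ℂ[X]) : (cj f).eval (y : ℂ) = star (f.eval (y : ℂ)) := by
  rw [cj_eval]; simp

lemma cj_natDegree (f : ℂ[X]) : (cj f).natDegree = f.natDegree := by
  unfold cj
  exact Polynomial.natDegree_map_eq_of_injective (RingHom.injective _) f

lemma ev_cT {m n : Type*} (y : ℝ) (M : Matrix m n ℂ[X]) : ev y (cT M) = (ev y M)ᴴ := by
  ext i j
  simp [cj_eval_real]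

/-- polynomials agreeing at cofinitely many reals agree -/
lemma poly_ext {p q : ℂ[X]} (h : ∀ᶠ y : ℝ in cofinite, p.eval (y : ℂ) = q.eval (y : ℂ)) : p = q := by
  apply Polynomial.eq_of_infinite_eval_eq
  have hinf : {y : ℝ | p.eval (y : ℂ) = q.eval (y : ℂ)}.Infinite := by
    have : ({y : ℝ | p.eval (y : ℂ) = q.eval (y : ℂ)}ᶜ).Finite := h
    exact Set.infinite_of_finite_compl this
  refine (hinf.image (f := fun y : ℝ => (y : ℂ)) (fun a _ b _ hab => Complex.ofReal_injective hab)).mono ?_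
  rintro _ ⟨y, hy, rfl⟩
  exact hy

lemma mat_ext {m n : Type*} [Finite m] [Finite n] {M N : Matrix m n ℂ[X]}
    (h : ∀ᶠ y : ℝ in cofinite, ev y M = ev y N) : M = N := by
  refine Matrix.ext fun i j => ?_
  apply poly_ext
  filter_upwards [h] with y hy
  exact congrFun (congrFun hy i) j

lemma eval_ne (p : ℂ[X]) (hp : p ≠ 0) : ∀ᶠ y : ℝ in cofinite, p.eval (y : ℂ) ≠ 0 := by
  have hf : {z : ℂ | p.eval z = 0}.Finite := by
    have := p.roots.toFinset.finite_toSet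
    refine this.subset ?_
    intro z hz
    simpa [hp] using hz
  have : ({y : ℝ | p.eval (y : ℂ) = 0}).Finite :=
    hf.preimage (f := fun y : ℝ => (y : ℂ)) (fun a _ b _ hab => Complex.ofReal_injective hab)
  have h2 : ({y : ℝ | p.eval (y : ℂ) ≠ 0}ᶜ).Finite := by
    refine this.subset ?_
    intro y hy
    simpa using hy
  exact h2

/-- nonnegative polynomials on cofinitely many reals -/
lemma exists_real_of_nonneg (f : ℂ[X]) (h : ∀ᶠ y : ℝ in cofinite, 0 ≤ f.eval (y : ℂ)) :
    ∃ g : ℝ[X], g.map (algebraMap ℝ ℂ) = f ∧ ∀ y : ℝ, 0 ≤ g.eval y := by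
  have hcj : cj f = f := by
    apply poly_ext
    filter_upwards [h] with y hy
    rw [cj_eval_real]
    exact (IsSelfAdjoint.of_nonneg hy)
  have hl : f ∈ Polynomial.lifts (algebraMap ℝ ℂ) := by
    rw [Polynomial.lifts_iff_coeff_lifts]
    intro n
    have h1 : starRingEnd ℂ (f.coeff n) = f.coeff n := by
      have := congrArg (fun q => q.coeff n) hcj
      simpa [cj] using this
    obtain ⟨r, hr⟩ := Complex.conj_eq_iff_real.1 h1
    exact ⟨r, by simpa using hr.symm⟩
  obtain ⟨g, hg⟩ := hl
  have hg' : g.map (algebraMap ℝ ℂ) = f := by simpa using hg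
  refine ⟨g, hg', ?_⟩
  have hev : ∀ y : ℝ, f.eval (y : ℂ) = ((g.eval y : ℝ) : ℂ) := by
    intro y
    rw [← hg', Polynomial.eval_map]
    have := Polynomial.eval₂_at_apply (p := g) (algebraMap ℝ ℂ) y
    simpa using this
  have hd : Dense {y : ℝ | 0 ≤ g.eval y} := by
    have hf : ({y : ℝ | 0 ≤ g.eval y}ᶜ).Finite := by
      have h' : ∀ᶠ y : ℝ in cofinite, 0 ≤ g.eval y := by
        filter_upwards [h] with y hy
        rw [hev] at hy
        exact_mod_cast hy
      exact h'
    have := hf.countable.dense_compl ℝ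
    simpa using this
  have hc : IsClosed {y : ℝ | 0 ≤ g.eval y} := isClosed_le continuous_const g.continuous
  intro y
  have := hd.closure_eq ▸ (Set.mem_univ y)
  rw [hc.closure_eq] at this
  exact this

lemma eval_map_real (g : ℝ[X]) (y : ℝ) :
    (g.map (algebraMap ℝ ℂ)).eval (y : ℂ) = ((g.eval y : ℝ) : ℂ) := by
  rw [Polynomial.eval_map]
  have := Polynomial.eval₂_at_apply (p := g) (algebraMap ℝ ℂ) y
  simpa using this

/-- real roots are double -/
lemma double_root (f g : ℂ[X]) (a : ℝ) (h : ∀ᶠ y : ℝ in cofinite, 0 ≤ f.eval (y : ℂ))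
    (hf : f = (X - C (a : ℂ)) * g) : g.eval (a : ℂ) = 0 := by
  obtain ⟨q, hq, hpos⟩ := exists_real_of_nonneg f h
  have h0 : q.eval a = 0 := by
    have : f.eval (a : ℂ) = 0 := by simp [hf]
    rw [← hq, eval_map_real] at this
    exact_mod_cast this
  have hmin : IsLocalMin (fun y => q.eval y) a := by
    apply Filter.Eventually.of_forall
    intro y
    show q.eval a ≤ q.eval y
    rw [h0]; exact hpos y
  have hd := hmin.deriv_eq_zero
  rw [Polynomial.deriv] at hd
  have h1 : (derivative f).eval (a : ℂ) = 0 := by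
    rw [← hq, Polynomial.derivative_map, eval_map_real, hd]; simp
  rw [hf] at h1
  simpa using h1

/-- nonnegative polynomials have even degree -/
lemma even_deg (f : ℂ[X]) (m : ℕ) (hm : 0 < m) (h : ∀ᶠ y : ℝ in cofinite, 0 ≤ f.eval (y : ℂ))
    (hf : f.natDegree ≤ 2 * m) (h0 : f.coeff (2 * m) = 0) : f.natDegree ≤ 2 * m - 2 := by
  obtain ⟨q, hq, hpos⟩ := exists_real_of_nonneg f h
  have hdeg : f.natDegree = q.natDegree := by
    rw [← hq]; exact Polynomial.natDegree_map_eq_of_injective (RingHom.injective _) q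
  have hne : f.natDegree ≠ 2 * m := by
    intro hh
    have : f = 0 := by
      rw [← hh] at h0
      exact Polynomial.leadingCoeff_eq_zero.1 h0
    rw [this] at hh
    simp at hh; omega
  by_contra hcon
  have hqd : q.natDegree = 2 * m - 1 := by omega
  have hodd : Odd q.natDegree := ⟨m - 1, by omega⟩
  have hq0 : q ≠ 0 := by
    rintro rfl
    simp at hqd; omega
  have key : ∀ r : ℝ[X], 0 < r.natDegree → (∀ y, 0 ≤ r.eval y) → 0 < r.leadingCoeff := by
    intro r hr hp
    by_contra hc
    have := Polynomial.tendsto_atBot_of_leadingCoeff_nonpos r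
      (Polynomial.natDegree_pos_iff_degree_pos.1 hr) (not_lt.1 hc)
    have h2 := this.eventually (eventually_lt_atBot (0:ℝ))
    obtain ⟨y, hy⟩ := h2.exists
    linarith [hp y]
  have k1 := key q (by omega) hpos
  have hnd : (q.comp (-X)).natDegree = q.natDegree := by
    rw [Polynomial.natDegree_comp]; simp
  have k2 := key (q.comp (-X)) (by omega) (fun y => by simpa using hpos (-y))
  rw [Polynomial.leadingCoeff_comp (by simp)] at k2
  simp [hodd.neg_one_pow] at k2
  linarith

/-- Top coefficient of a determinant with weighted degree bounds. -/
lemma coeff_prod_le {ι : Type*} (s : Finset ι) (f : ι → ℂ[X]) (b : ι → ℕ)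
    (h : ∀ i ∈ s, (f i).natDegree ≤ b i) :
    (∏ i ∈ s, f i).natDegree ≤ ∑ i ∈ s, b i ∧
    (∏ i ∈ s, f i).coeff (∑ i ∈ s, b i) = ∏ i ∈ s, (f i).coeff (b i) := by
  classical
  induction s using Finset.induction_on with
  | empty => simp
  | insert a s ha ih =>
    have ih' := ih (fun i hi => h i (Finset.mem_insert_of_mem hi))
    have h1 := h a (Finset.mem_insert_self _ _)
    rw [Finset.prod_insert ha, Finset.sum_insert ha, Finset.prod_insert ha]
    refine ⟨Polynomial.natDegree_mul_le.trans (add_le_add h1 ih'.1), ?_⟩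
    rw [Polynomial.coeff_mul_add_eq_of_natDegree_le h1 ih'.1, ih'.2]

lemma coeff_det {ι : Type*} [Fintype ι] [DecidableEq ι] (H : Matrix ι ι ℂ[X]) (m : ι → ℕ)
    (h : ∀ i j, (H i j).natDegree ≤ m i + m j) :
    H.det.coeff (∑ i, m i + ∑ i, m i) = (Matrix.of fun i j => (H i j).coeff (m i + m j)).det := by
  rw [Matrix.det_apply, Matrix.det_apply, Polynomial.finsetSum_coeff]
  refine Finset.sum_congr rfl fun σ _ => ?_
  rw [Polynomial.coeff_smul]
  congr 1
  have hs : ∑ i, m i + ∑ i, m i = ∑ i, (m (σ i) + m i) := by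
    rw [Finset.sum_add_distrib, Equiv.sum_comp σ m]
  rw [hs, (coeff_prod_le Finset.univ (fun i => H (σ i) i) (fun i => m (σ i) + m i)
    (fun i _ => h _ _)).2]
  rfl

end HV

end

section

open Polynomial Filter
open scoped ComplexOrder

namespace HV

variable {ι : Type*} [Fintype ι] [DecidableEq ι]

/-- A generically positive Hermitian polynomial form together with a selfadjoint endomorphism. -/
structure Good (H K : Matrix ι ι ℂ[X]) (m : ι → ℕ) : Prop where
  psd : ∀ᶠ y : ℝ in cofinite, (ev y H).PosSemidef
  sa : ∀ᶠ y : ℝ in cofinite, ev y H * ev y K = (ev y K)ᴴ * ev y H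
  det : H.det ≠ 0
  deg : ∀ i j, (H i j).natDegree ≤ m i + m j

lemma Good.herm {H K : Matrix ι ι ℂ[X]} {m : ι → ℕ} (h : Good H K m) (i j : ι) :
    cj (H i j) = H j i := by
  apply poly_ext
  filter_upwards [h.psd] with y hy
  rw [cj_eval_real]
  exact hy.1.apply j i

lemma Good.saP {H K : Matrix ι ι ℂ[X]} {m : ι → ℕ} (h : Good H K m) :
    H * K = cT K * H := by
  apply mat_ext
  filter_upwards [h.sa] with y hy
  rw [ev_mul, ev_mul, ev_cT, hy]

lemma Good.diag {H K : Matrix ι ι ℂ[X]} {m : ι → ℕ} (h : Good H K m) (i : ι) :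
    ∀ᶠ y : ℝ in cofinite, 0 ≤ (H i i).eval (y : ℂ) := by
  filter_upwards [h.psd] with y hy
  exact hy.diag_nonneg (i := i)

/-- diagonal entries are nonzero -/
lemma Good.diag_ne {H K : Matrix ι ι ℂ[X]} {m : ι → ℕ} (h : Good H K m) (i : ι) :
    H i i ≠ 0 := by
  intro h0
  apply h.det
  apply Matrix.det_eq_zero_of_column_eq_zero i
  intro k
  apply poly_ext
  filter_upwards [h.psd] with y hy
  have h1 : star (Pi.single i (1:ℂ)) ⬝ᵥ (ev y H *ᵥ Pi.single i (1:ℂ)) = 0 := by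
    rw [Matrix.mulVec_single_one]
    rw [← Pi.single_star]
    simp [h0]
  have h2 := (hy.dotProduct_mulVec_zero_iff _).1 h1
  have := congrFun h2 k
  rw [Matrix.mulVec_single_one] at this
  simpa using this

lemma charpoly_eq_of_intertwine (K K' D : Matrix ι ι ℂ[X]) (hD : D.det ≠ 0)
    (h : K' * D = D * K) : K'.charpoly = K.charpoly := by
  have hC : ∀ M : Matrix ι ι ℂ[X], M.charmatrix = Matrix.scalar ι (X : ℂ[X][X]) - M.map C := fun M => rfl
  have h1 : K'.charmatrix * D.map C = D.map C * K.charmatrix := by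
    rw [hC, hC, Matrix.sub_mul, Matrix.mul_sub]
    congr 1
    · exact (Matrix.scalar_commute _ (fun r => Commute.all _ _) _).eq
    · rw [← Matrix.map_mul, ← Matrix.map_mul, h]
  have h2 := congrArg Matrix.det h1
  rw [Matrix.det_mul, Matrix.det_mul, mul_comm] at h2
  have h3 : (D.map C).det ≠ 0 := by
    have := RingHom.map_det (C : ℂ[X] →+* ℂ[X][X]) D
    have e : (D.map C).det = C D.det := by rw [this]; rfl
    rw [e]
    simpa using hD
  exact mul_left_cancel₀ h3 h2

/-- change of basis -/
lemma Good.transform {H K : Matrix ι ι ℂ[X]} {m : ι → ℕ} (h : Good H K m)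
    (E : Matrix ι ι ℂ[X]) (hE : E.det = 1)
    (hdeg : ∀ j k, E j k ≠ 0 → (E j k).natDegree + m j ≤ m k) :
    Good (cT E * H * E) (E.adjugate * K * E) m ∧
      (E.adjugate * K * E).charpoly = K.charpoly := by
  have hEA : E * E.adjugate = 1 := by rw [Matrix.mul_adjugate, hE, one_smul]
  have hAE : E.adjugate * E = 1 := by rw [Matrix.adjugate_mul, hE, one_smul]
  refine ⟨⟨?_, ?_, ?_, ?_⟩, ?_⟩
  · filter_upwards [h.psd] with y hy
    rw [ev_mul, ev_mul, ev_cT]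
    exact hy.conjTranspose_mul_mul_same _
  · filter_upwards [h.sa] with y hy
    have h1 : ev y E * ev y E.adjugate = 1 := by rw [← ev_mul, hEA, ev_one]
    have h2 : (ev y E.adjugate)ᴴ * (ev y E)ᴴ = 1 := by
      rw [← Matrix.conjTranspose_mul, h1, Matrix.conjTranspose_one]
    simp only [ev_mul, ev_cT, Matrix.conjTranspose_mul]
    calc (ev y E)ᴴ * ev y H * ev y E * (ev y E.adjugate * ev y K * ev y E)
        = (ev y E)ᴴ * ev y H * (ev y E * ev y E.adjugate) * ev y K * ev y E := by
          simp only [Matrix.mul_assoc]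
      _ = (ev y E)ᴴ * (ev y H * ev y K) * ev y E := by
          rw [h1, Matrix.mul_one]; simp only [Matrix.mul_assoc]
      _ = (ev y E)ᴴ * (ev y K)ᴴ * ((ev y E.adjugate)ᴴ * (ev y E)ᴴ) * ev y H * ev y E := by
          rw [hy, h2, Matrix.mul_one]; simp only [Matrix.mul_assoc]
      _ = _ := by simp only [Matrix.mul_assoc]
  · have hc : (cT E).det = 1 := by
      unfold cT
      rw [Matrix.det_transpose]
      have := RingHom.map_det cj E
      rw [hE, map_one] at this
      rw [this]; rfl
    rw [Matrix.det_mul, Matrix.det_mul, hc, hE]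
    simpa using h.det
  · intro k l
    rw [Matrix.mul_apply]
    refine Polynomial.natDegree_sum_le_of_forall_le _ _ fun j _ => ?_
    by_cases hj : E j l = 0
    · simp [hj]
    rw [Matrix.mul_apply, Finset.sum_mul]
    refine Polynomial.natDegree_sum_le_of_forall_le _ _ fun i _ => ?_
    by_cases hi : E i k = 0
    · simp [hi]
    have a1 := hdeg _ _ hj
    have a2 := hdeg _ _ hi
    have a3 := h.deg i j
    have a4 := cj_natDegree (E i k)
    rw [cT_apply]
    have b1 := Polynomial.natDegree_mul_le (p := cj (E i k) * H i j) (q := E j l)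
    have b2 := Polynomial.natDegree_mul_le (p := cj (E i k)) (q := H i j)
    omega
  · apply charpoly_eq_of_intertwine K _ E.adjugate
    · intro h0
      have h1 := congrArg Matrix.det hEA
      rw [Matrix.det_mul, h0, mul_zero, Matrix.det_one] at h1
      exact zero_ne_one h1
    · rw [Matrix.mul_assoc, hEA, Matrix.mul_one]

/-- lowering a weight -/
lemma Good.lower {H K : Matrix ι ι ℂ[X]} {m : ι → ℕ} (h : Good H K m) (i : ι) (hi : 0 < m i)
    (hc : ∀ k, (H k i).coeff (m k + m i) = 0) :
    Good H K (Function.update m i (m i - 1)) := by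
  refine ⟨h.psd, h.sa, h.det, ?_⟩
  have hii : (H i i).natDegree ≤ 2 * m i - 2 := by
    refine even_deg _ _ hi (h.diag i) ?_ ?_
    · have := h.deg i i; omega
    · have := hc i; rwa [← two_mul] at this
  have hki : ∀ k, (H k i).natDegree ≤ m k + m i - 1 := by
    intro k
    have h1 := h.deg k i
    by_contra hcon
    have h2 : (H k i).natDegree = m k + m i := by omega
    have h3 := hc k
    rw [← h2] at h3
    have : H k i = 0 := Polynomial.leadingCoeff_eq_zero.1 h3
    rw [this] at h2
    simp at h2; omega
  have hik : ∀ k, (H i k).natDegree ≤ m k + m i - 1 := by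
    intro k
    rw [← h.herm, cj_natDegree]; exact hki k
  intro k l
  have hkl := h.deg k l
  by_cases h1 : k = i <;> by_cases h2 : l = i
  · subst h1; subst h2; simp; omega
  · subst h1; have := hik l; simp [h2]; omega
  · subst h2; have := hki k; simp [h1]; omega
  · simp [h1, h2, hkl]

/-- dividing a basis vector by a linear form -/
lemma Good.divide {H K : Matrix ι ι ℂ[X]} {m : ι → ℕ} (h : Good H K m) (i : ι) (hi : 0 < m i)
    (a : ℂ) (hH : ∀ k, (H k i).eval a = 0) (hK : ∀ k, k ≠ i → (K k i).eval a = 0) :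
    ∃ H' K' : Matrix ι ι ℂ[X], Good H' K' (Function.update m i (m i - 1)) ∧
      K'.charpoly = K.charpoly := by
  have hg : ∀ k, ∃ g, H k i = (X - C a) * g := fun k => Polynomial.dvd_iff_isRoot.2 (hH k)
  choose g hg using hg
  have hu : ∀ k, ∃ u, k ≠ i → K k i = (X - C a) * u := fun k => by
    by_cases hk : k = i
    · exact ⟨0, fun h => absurd hk h⟩
    · obtain ⟨u, hu⟩ := Polynomial.dvd_iff_isRoot.2 (hK k hk)
      exact ⟨u, fun _ => hu⟩
  choose u hu using hu
  have hcjl : cj (X - C a) = X - C (starRingEnd ℂ a) := by simp [cj]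
  have hr : ∃ r, g i = (X - C (starRingEnd ℂ a)) * r := by
    apply Polynomial.dvd_iff_isRoot.2
    show (g i).eval _ = 0
    by_cases hreal : starRingEnd ℂ a = a
    · obtain ⟨b, rfl⟩ := Complex.conj_eq_iff_real.1 hreal
      rw [Complex.conj_ofReal]
      exact double_root _ _ b (h.diag i) (hg i)
    · have h1 : (H i i).eval (starRingEnd ℂ a) = 0 := by
        rw [← h.herm i i, cj_eval]; simp [hH]
      rw [hg i] at h1
      have h2 : starRingEnd ℂ a - a ≠ 0 := sub_ne_zero.2 hreal
      simpa [h2] using h1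
  obtain ⟨r, hr⟩ := hr
  let H' : Matrix ι ι ℂ[X] := fun k l =>
    if k = i then (if l = i then r else cj (g l)) else (if l = i then g k else H k l)
  let K' : Matrix ι ι ℂ[X] := fun k l =>
    if k = i then (if l = i then K i i else (X - C a) * K i l) else (if l = i then u k else K k l)
  let δ : ι → ℂ[X] := fun k => if k = i then X - C a else 1
  let D : Matrix ι ι ℂ[X] := Matrix.diagonal δ
  have hcTD : cT D = Matrix.diagonal (fun k => cj (δ k)) := by
    refine Matrix.ext fun k l => ?_
    by_cases hkl : k = l
    · subst hkl; simp [D]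
    · simp [D, hkl, Ne.symm hkl]
  have hHD : H = cT D * H' * D := by
    refine Matrix.ext fun k l => ?_
    rw [hcTD, Matrix.mul_diagonal, Matrix.diagonal_mul]
    by_cases h1 : k = i <;> by_cases h2 : l = i
    · subst h1; subst h2; simp only [H', δ, if_true, hcjl]; rw [hg, hr]; ring
    · subst h1; simp only [H', δ, if_true, h2, if_false]
      rw [← map_mul, ← hg, h.herm]; ring
    · subst h2; simp only [H', δ, if_true, h1, if_false]
      rw [hg, map_one]; ring
    · simp [H', δ, h1, h2]
  have hKD : K' * D = D * K := by
    refine Matrix.ext fun k l => ?_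
    rw [Matrix.mul_diagonal, Matrix.diagonal_mul]
    by_cases h1 : k = i <;> by_cases h2 : l = i
    · subst h1; subst h2; simp only [K', δ, if_true]; ring
    · subst h1; simp [K', δ, h2]
    · subst h2; simp only [K', δ, if_true, h1, if_false]
      rw [hu k h1]; ring
    · simp [K', δ, h1, h2]
  have hDdet : D.det ≠ 0 := by
    rw [Matrix.det_diagonal]
    refine Finset.prod_ne_zero_iff.2 fun k _ => ?_
    by_cases hk : k = i
    · simp only [δ, hk, if_true]; exact Polynomial.X_sub_C_ne_zero a
    · simp [δ, hk]
  refine ⟨H', K', ⟨?_, ?_, ?_, ?_⟩, charpoly_eq_of_intertwine K K' D hDdet hKD⟩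
  · filter_upwards [h.psd, eval_ne _ hDdet] with y hy hd
    rw [← ev_det] at hd
    have hU : IsUnit (ev y D) := (Matrix.isUnit_iff_isUnit_det _).2 (isUnit_iff_ne_zero.2 hd)
    rw [hHD, ev_mul, ev_mul, ev_cT] at hy
    exact (hU.posSemidef_star_left_conjugate_iff).1 hy
  · filter_upwards [h.sa, eval_ne _ hDdet] with y hy hd
    rw [← ev_det] at hd
    have hU : IsUnit (ev y D) := (Matrix.isUnit_iff_isUnit_det _).2 (isUnit_iff_ne_zero.2 hd)
    have hU' : IsUnit (ev y D)ᴴ := hU.star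
    have e1 : ev y H = (ev y D)ᴴ * ev y H' * ev y D := by
      rw [← ev_cT, ← ev_mul, ← ev_mul, ← hHD]
    have e2 : ev y K' * ev y D = ev y D * ev y K := by rw [← ev_mul, ← ev_mul, hKD]
    have e3 : (ev y D)ᴴ * (ev y K')ᴴ = (ev y K)ᴴ * (ev y D)ᴴ := by
      rw [← Matrix.conjTranspose_mul, e2, Matrix.conjTranspose_mul]
    apply hU'.mul_left_cancel
    apply hU.mul_right_cancel
    calc (ev y D)ᴴ * (ev y H' * ev y K') * ev y D
        = (ev y D)ᴴ * ev y H' * (ev y K' * ev y D) := by simp only [Matrix.mul_assoc]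
      _ = ev y H * ev y K := by rw [e2, e1]; simp only [Matrix.mul_assoc]
      _ = ((ev y K)ᴴ * (ev y D)ᴴ) * ev y H' * ev y D := by
          rw [hy, e1]; simp only [Matrix.mul_assoc]
      _ = _ := by rw [← e3]; simp only [Matrix.mul_assoc]
  · intro h0
    apply h.det
    rw [hHD, Matrix.det_mul, Matrix.det_mul, h0]; simp
  · have hgdeg : ∀ k, (g k).natDegree ≤ m k + m i - 1 := by
      intro k
      by_cases h0 : g k = 0
      · simp [h0]
      have h1 := h.deg k i
      rw [hg k, Polynomial.natDegree_mul (Polynomial.X_sub_C_ne_zero a) h0,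
        Polynomial.natDegree_X_sub_C] at h1
      omega
    have hrdeg : r.natDegree ≤ 2 * m i - 2 := by
      by_cases h0 : r = 0
      · simp [h0]
      have h1 := hgdeg i
      rw [hr, Polynomial.natDegree_mul (Polynomial.X_sub_C_ne_zero _) h0,
        Polynomial.natDegree_X_sub_C] at h1
      omega
    intro k l
    have hkl := h.deg k l
    by_cases h1 : k = i <;> by_cases h2 : l = i
    · subst h1; subst h2; simp [H']; omega
    · subst h1; have := hgdeg l; simp [H', h2, cj_natDegree]; omega
    · subst h2; have := hgdeg k; simp [H', h1]; omega
    · simp [H', h1, h2, hkl]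

end HV

end

section

open Polynomial Filter
open scoped ComplexOrder

namespace HV

set_option linter.unusedSectionVars false
variable {ι : Type*} [Fintype ι] [DecidableEq ι]

/-- the elementary base change -/
def elem (i : ι) (v : ι → ℂ[X]) : Matrix ι ι ℂ[X] := (1 : Matrix ι ι ℂ[X]).updateCol i v

lemma elem_det (i : ι) (v : ι → ℂ[X]) : (elem i v).det = v i := by
  unfold elem
  rw [← Matrix.cramer_apply, Matrix.cramer_one]; rfl

lemma elem_col (i : ι) (v : ι → ℂ[X]) (j : ι) : elem i v j i = v j := by
  simp [elem]

lemma mul_elem (M : Matrix ι ι ℂ[X]) (i : ι) (v : ι → ℂ[X]) (k : ι) :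
    (M * elem i v) k i = (M *ᵥ v) k := by
  simp [Matrix.mul_apply, Matrix.mulVec, dotProduct, elem_col]

lemma elem_deg (m : ι → ℕ) (i : ι) (c : ι → ℂ) (e : ι → ℕ)
    (he : ∀ j, c j ≠ 0 → e j + m j ≤ m i) (j k : ι)
    (h : elem i (fun j => C (c j) * X ^ e j) j k ≠ 0) :
    (elem i (fun j => C (c j) * X ^ e j) j k).natDegree + m j ≤ m k := by
  by_cases hk : k = i
  · subst hk
    rw [elem_col] at h ⊢
    have hc : c j ≠ 0 := by
      intro h0; simp [h0] at h
    have := Polynomial.natDegree_C_mul_X_pow_le (c j) (e j)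
    have := he j hc
    omega
  · simp only [elem, Matrix.updateCol_apply, hk, if_false] at h ⊢
    by_cases hjk : j = k
    · subst hjk; simp
    · simp [hjk] at h

/-- choosing a pivot of maximal weight -/
lemma exists_pivot (m : ι → ℕ) (c : ι → ℂ) (hc : c ≠ 0) :
    ∃ i, c i ≠ 0 ∧ ∀ j, c j ≠ 0 → m j ≤ m i := by
  have hne : (Finset.univ.filter fun j => c j ≠ 0).Nonempty := by
    obtain ⟨j, hj⟩ := Function.ne_iff.1 hc
    exact ⟨j, by simpa using hj⟩
  obtain ⟨i, hi, hmax⟩ := Finset.exists_max_image _ m hne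
  exact ⟨i, by simpa using hi, fun j hj => hmax j (by simpa using hj)⟩

lemma sum_update_lt (m : ι → ℕ) (i : ι) (hi : 0 < m i) :
    ∑ j, Function.update m i (m i - 1) j < ∑ j, m j := by
  apply Finset.sum_lt_sum
  · intro j _
    by_cases hj : j = i
    · subst hj; simp
    · simp [hj]
  · exact ⟨i, Finset.mem_univ _, by simp; omega⟩

lemma Good.stepA {H K : Matrix ι ι ℂ[X]} {m : ι → ℕ} (h : Good H K m)
    (hM : (Matrix.of fun i j => (H i j).coeff (m i + m j)).det = 0) :
    ∃ (H' K' : Matrix ι ι ℂ[X]) (m' : ι → ℕ), Good H' K' m' ∧ K'.charpoly = K.charpoly ∧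
      ∑ j, m' j < ∑ j, m j := by
  obtain ⟨c, hc0, hc⟩ := Matrix.exists_mulVec_eq_zero_iff.2 hM
  obtain ⟨i, hi0, hmax⟩ := exists_pivot m c hc0
  -- normalise
  obtain ⟨c, hci, hmax, hc⟩ : ∃ c : ι → ℂ, c i = 1 ∧ (∀ j, c j ≠ 0 → m j ≤ m i) ∧
      (Matrix.of fun i j => (H i j).coeff (m i + m j)) *ᵥ c = 0 := by
    refine ⟨(c i)⁻¹ • c, by simp [hi0], ?_, by rw [Matrix.mulVec_smul, hc, smul_zero]⟩
    intro j hj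
    apply hmax
    intro h0; simp [h0] at hj
  clear hi0 hc0
  set v : ι → ℂ[X] := fun j => C (c j) * X ^ (m i - m j) with hv
  have hdeg := elem_deg m i c (fun j => m i - m j) (fun j hj => by have := hmax j hj; omega)
  obtain ⟨hG, hcp⟩ := h.transform (elem i v) (by rw [elem_det]; simp [hv, hci]) hdeg
  have hHv : ∀ j, ((H *ᵥ v) j).natDegree ≤ m j + m i ∧ ((H *ᵥ v) j).coeff (m j + m i) = 0 := by
    intro j
    have hterm : ∀ l, (H j l * v l).natDegree ≤ m j + m i ∧
        (H j l * v l).coeff (m j + m i) = (H j l).coeff (m j + m l) * c l := by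
      intro l
      by_cases hl : c l = 0
      · simp [hv, hl]
      have h1 := hmax l hl
      have h2 : (v l).natDegree ≤ m i - m l := Polynomial.natDegree_C_mul_X_pow_le _ _
      have h3 : m j + m i = (m j + m l) + (m i - m l) := by omega
      rw [h3]
      refine ⟨Polynomial.natDegree_mul_le.trans (add_le_add (h.deg j l) h2), ?_⟩
      rw [Polynomial.coeff_mul_add_eq_of_natDegree_le (h.deg j l) h2]
      simp [hv]
    refine ⟨Polynomial.natDegree_sum_le_of_forall_le _ _ fun l _ => (hterm l).1, ?_⟩
    have := congrFun hc j
    simp only [Matrix.mulVec, dotProduct, Polynomial.finsetSum_coeff] at this ⊢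
    rw [Finset.sum_congr rfl fun l _ => (hterm l).2]
    simpa using this
  have hcol : ∀ k, ((cT (elem i v) * H * elem i v) k i).coeff (m k + m i) = 0 := by
    intro k
    rw [mul_elem, ← Matrix.mulVec_mulVec]
    simp only [Matrix.mulVec, dotProduct, Polynomial.finsetSum_coeff]
    refine Finset.sum_eq_zero fun j _ => ?_
    by_cases hj : elem i v j k = 0
    · simp [hj]
    have h1 : (elem i v j k).natDegree + m j ≤ m k := hdeg j k hj
    have h2 := (hHv j)
    have h3 : (cT (elem i v) k j).natDegree ≤ m k - m j := by
      rw [cT_apply, cj_natDegree]; omega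
    have h4 : m k + m i = (m k - m j) + (m j + m i) := by omega
    have h5 := Polynomial.coeff_mul_add_eq_of_natDegree_le h3 h2.1
    rw [h2.2, mul_zero, ← h4] at h5
    exact h5
  have hmi : 0 < m i := by
    rcases Nat.eq_zero_or_pos (m i) with h0 | h0
    · exfalso
      apply hG.diag_ne i
      have h1 := hG.deg i i
      have h2 := hcol i
      rw [h0] at h1 h2
      rw [Polynomial.eq_C_of_natDegree_le_zero h1, h2, map_zero]
    · exact h0
  exact ⟨_, _, _, hG.lower i hmi hcol, hcp, sum_update_lt m i hmi⟩

lemma Good.stepB {H K : Matrix ι ι ℂ[X]} {m : ι → ℕ} (h : Good H K m)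
    (a : ℂ) (ha : H.det.eval a = 0) :
    ∃ (H' K' : Matrix ι ι ℂ[X]) (m' : ι → ℕ), Good H' K' m' ∧ K'.charpoly = K.charpoly ∧
      ∑ j, m' j < ∑ j, m j := by
  -- an eigenvector in the kernel
  obtain ⟨c, μ, hc0, hHc, hKc⟩ : ∃ (c : ι → ℂ) (μ : ℂ), c ≠ 0 ∧ ev a H *ᵥ c = 0 ∧
      ev a K *ᵥ c = μ • c := by
    have hsa : ev a H * ev a K = ev a (cT K) * ev a H := by rw [← ev_mul, h.saP, ev_mul]
    let N := LinearMap.ker (Matrix.toLin' (ev a H))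
    have hinv : ∀ x ∈ N, Matrix.toLin' (ev a K) x ∈ N := by
      intro x hx
      rw [LinearMap.mem_ker, Matrix.toLin'_apply] at hx ⊢
      rw [Matrix.toLin'_apply, Matrix.mulVec_mulVec, hsa, ← Matrix.mulVec_mulVec, hx,
        Matrix.mulVec_zero]
    rw [← ev_det] at ha
    obtain ⟨w, hw0, hw⟩ := Matrix.exists_mulVec_eq_zero_iff.2 ha
    have : Nontrivial N := by
      refine ⟨⟨⟨w, ?_⟩, 0, ?_⟩⟩
      · rw [LinearMap.mem_ker, Matrix.toLin'_apply]; exact hw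
      · intro hh; exact hw0 (congrArg Subtype.val hh)
    obtain ⟨μ, hμ⟩ := Module.End.exists_eigenvalue ((Matrix.toLin' (ev a K)).restrict hinv)
    obtain ⟨x, hx⟩ := hμ.exists_hasEigenvector
    refine ⟨x, μ, fun h0 => hx.2 (Subtype.ext h0), ?_, ?_⟩
    · have := x.2
      rwa [LinearMap.mem_ker, Matrix.toLin'_apply] at this
    · have := congrArg Subtype.val hx.apply_eq_smul
      simpa using this
  obtain ⟨i, hi0, hmax⟩ := exists_pivot m c hc0
  obtain ⟨c, hci, hmax, hHc, hKc⟩ : ∃ c : ι → ℂ, c i = 1 ∧ (∀ j, c j ≠ 0 → m j ≤ m i) ∧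
      ev a H *ᵥ c = 0 ∧ ev a K *ᵥ c = μ • c := by
    refine ⟨(c i)⁻¹ • c, by simp [hi0], ?_, by rw [Matrix.mulVec_smul, hHc, smul_zero],
      by rw [Matrix.mulVec_smul, hKc, smul_comm]⟩
    intro j hj
    apply hmax
    intro h0; simp [h0] at hj
  clear hi0 hc0
  set v : ι → ℂ[X] := fun j => C (c j) * X ^ 0 with hv
  have hvev : (fun j => (v j).eval a) = c := by ext j; simp [hv]
  have hdeg := elem_deg m i c (fun _ => 0) (fun j hj => by have := hmax j hj; omega)
  have hEdet : (elem i v).det = 1 := by rw [elem_det]; simp [hv, hci]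
  obtain ⟨hG, hcp⟩ := h.transform (elem i v) hEdet hdeg
  have hcol : ∀ k, ((cT (elem i v) * H * elem i v) k i).eval a = 0 := by
    intro k
    rw [mul_elem, ← Matrix.mulVec_mulVec]
    have h1 := congrFun (ev_mulVec a (cT (elem i v)) (H *ᵥ v)) k
    rw [← h1, ← ev_mulVec, hvev, hHc, Matrix.mulVec_zero]; rfl
  have hcolK : ∀ k, k ≠ i → (((elem i v).adjugate * K * elem i v) k i).eval a = 0 := by
    intro k hk
    rw [mul_elem, ← Matrix.mulVec_mulVec]
    have h1 := congrFun (ev_mulVec a ((elem i v).adjugate) (K *ᵥ v)) k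
    rw [← h1, ← ev_mulVec, hvev, hKc, Matrix.mulVec_smul, ← hvev, ev_mulVec]
    have h2 : ((elem i v).adjugate *ᵥ v) k = 0 := by
      rw [← mul_elem, Matrix.adjugate_mul, hEdet]; simp [hk]
    simp [h2]
  have hmi : 0 < m i := by
    rcases Nat.eq_zero_or_pos (m i) with h0 | h0
    · exfalso
      apply hG.diag_ne i
      have h1 := hG.deg i i
      have h2 := hcol i
      rw [h0] at h1
      rw [Polynomial.eq_C_of_natDegree_le_zero h1] at h2 ⊢
      rw [Polynomial.eval_C] at h2
      rw [h2, map_zero]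
    · exact h0
  obtain ⟨H', K', hG', hcp'⟩ := hG.divide i hmi a hcol hcolK
  exact ⟨_, _, _, hG', hcp'.trans hcp, sum_update_lt m i hmi⟩

lemma Good.step {H K : Matrix ι ι ℂ[X]} {m : ι → ℕ} (h : Good H K m) (hm : 0 < ∑ j, m j) :
    ∃ (H' K' : Matrix ι ι ℂ[X]) (m' : ι → ℕ), Good H' K' m' ∧ K'.charpoly = K.charpoly ∧
      ∑ j, m' j < ∑ j, m j := by
  by_cases hM : (Matrix.of fun i j => (H i j).coeff (m i + m j)).det = 0
  · exact h.stepA hM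
  · rw [← coeff_det H m h.deg] at hM
    have h1 := Polynomial.le_natDegree_of_ne_zero hM
    obtain ⟨a, ha⟩ := IsAlgClosed.exists_root H.det (by
      intro h0
      have := Polynomial.natDegree_eq_of_degree_eq_some (n := 0) h0
      omega)
    exact h.stepB a ha

lemma Good.reduce (N : ℕ) : ∀ {H K : Matrix ι ι ℂ[X]} {m : ι → ℕ}, Good H K m → ∑ j, m j = N →
    ∃ (H' K' : Matrix ι ι ℂ[X]), Good H' K' 0 ∧ K'.charpoly = K.charpoly := by
  induction N using Nat.strong_induction_on with
  | _ N ih =>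
    intro H K m h hN
    rcases Nat.eq_zero_or_pos N with h0 | h0
    · refine ⟨H, K, ?_, rfl⟩
      have : m = 0 := by
        ext j
        have := (Finset.sum_eq_zero_iff.1 (hN.trans h0)) j (Finset.mem_univ _)
        exact this
      rwa [this] at h
    · obtain ⟨H', K', m', hG, hcp, hlt⟩ := h.step (hN ▸ h0)
      obtain ⟨H2, K2, hG2, hcp2⟩ := ih _ (hN ▸ hlt) hG rfl
      exact ⟨H2, K2, hG2, hcp2.trans hcp⟩

open scoped MatrixOrder in
lemma exists_star_mul_self {M : Matrix ι ι ℂ} (h : M.PosSemidef) : ∃ B, M = star B * B :=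
  CStarAlgebra.nonneg_iff_eq_star_mul_self.mp h.nonneg

lemma Good.exists_herm {H K : Matrix ι ι ℂ[X]} {m : ι → ℕ} (h : Good H K m) :
    ∃ L : Matrix ι ι ℂ[X], L.charpoly = K.charpoly ∧ cT L = L := by
  obtain ⟨H, K', h, hcp⟩ := h.reduce _ rfl
  rw [← hcp]
  clear hcp
  -- the constant form
  have hconst : H = (ev 0 H).map C := by
    refine Matrix.ext fun i j => ?_
    have h1 := Polynomial.eq_C_of_natDegree_le_zero (h.deg i j)
    rw [Matrix.map_apply, ev_apply]
    rw [h1]; simp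
  have hev : ∀ y : ℂ, ev y H = ev 0 H := by
    intro y
    rw [hconst]
    ext i j; simp
  obtain ⟨y, hy⟩ := h.psd.exists
  rw [hev] at hy
  obtain ⟨B, hB⟩ := exists_star_mul_self hy
  have hBdet : B.det ≠ 0 := by
    intro h0
    apply h.det
    have : (ev 0 H).det = 0 := by rw [hB, Matrix.det_mul, h0, mul_zero]
    rw [hconst]
    have := RingHom.map_det (C : ℂ →+* ℂ[X]) (ev 0 H)
    rw [show (ev 0 H).map C = (C : ℂ →+* ℂ[X]).mapMatrix (ev 0 H) from rfl, ← this, ‹(ev 0 H).det = 0›,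
      map_zero]
  have hBB : B * B⁻¹ = 1 := Matrix.mul_nonsing_inv _ (isUnit_iff_ne_zero.2 hBdet)
  have hBB' : B⁻¹ * B = 1 := Matrix.nonsing_inv_mul _ (isUnit_iff_ne_zero.2 hBdet)
  have hevC : ∀ (y : ℂ) (M : Matrix ι ι ℂ), ev y (M.map C) = M := by
    intro y M; ext i j; simp
  have hPP : (B⁻¹.map C : Matrix ι ι ℂ[X]) * B.map C = 1 := by
    rw [← Matrix.map_mul, hBB']; simp
  refine ⟨B.map C * K' * B⁻¹.map C, ?_, ?_⟩
  · apply charpoly_eq_of_intertwine _ _ (B.map C)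
    · intro h0
      have h1 := congrArg Matrix.det hPP
      rw [Matrix.det_mul, h0, mul_zero, Matrix.det_one] at h1
      exact zero_ne_one h1
    · rw [Matrix.mul_assoc, hPP, Matrix.mul_one]
  · apply mat_ext
    filter_upwards [h.sa] with y hy
    rw [hev, hB, Matrix.star_eq_conjTranspose] at hy
    rw [ev_cT]
    simp only [ev_mul, hevC, Matrix.conjTranspose_mul]
    have h2 : (B⁻¹)ᴴ * Bᴴ = 1 := by rw [← Matrix.conjTranspose_mul, hBB, Matrix.conjTranspose_one]
    calc (B⁻¹)ᴴ * ((ev y K')ᴴ * Bᴴ)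
        = (B⁻¹)ᴴ * ((ev y K')ᴴ * (Bᴴ * B)) * B⁻¹ := by
          have : (B⁻¹)ᴴ * ((ev y K')ᴴ * (Bᴴ * B)) * B⁻¹
            = (B⁻¹)ᴴ * ((ev y K')ᴴ * Bᴴ) * (B * B⁻¹) := by simp only [Matrix.mul_assoc]
          rw [this, hBB, Matrix.mul_one]
      _ = ((B⁻¹)ᴴ * Bᴴ) * B * ev y K' * B⁻¹ := by rw [← hy]; simp only [Matrix.mul_assoc]
      _ = _ := by rw [h2, Matrix.one_mul]

end HV

end

section

open Polynomial Filter
open scoped ComplexOrder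

namespace HV

/-- rational functions -/
abbrev Fr := FractionRing ℂ[X]

/-- algebraic functions -/
abbrev Fc := AlgebraicClosure Fr

lemma aeval_map_mat {R S : Type*} [CommRing R] [CommRing S] {n : Type*} [Fintype n] [DecidableEq n]
    (φ : R →+* S) (L : Matrix n n R) (f : R[X]) :
    (aeval L f).map φ = aeval (L.map φ) (f.map φ) := by
  rw [aeval_def, aeval_def, eval₂_map]
  have h := Polynomial.hom_eval₂ f (algebraMap R (Matrix n n R)) (φ.mapMatrix) L
  have h2 : φ.mapMatrix.comp (algebraMap R (Matrix n n R)) = (algebraMap S (Matrix n n S)).comp φ := by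
    ext r i j
    simp [Matrix.algebraMap_matrix_apply, apply_ite φ]
  rw [h2] at h
  exact h

lemma aeval_mulVec_comp {R : Type*} [CommRing R] {n : Type*} [Fintype n] [DecidableEq n]
    (L : Matrix n n R) (f g : R[X]) (w : n → R) :
    aeval L (f * g) *ᵥ w = aeval L f *ᵥ (aeval L g *ᵥ w) := by
  rw [map_mul, Matrix.mulVec_mulVec]

lemma det_aeval_eq_zero {n : Type*} [Fintype n] [DecidableEq n] (L : Matrix n n ℂ[X])
    (p : ℂ[X][X]) (hp : p.Monic) (hirr : Irreducible p) (hdvd : p ∣ L.charpoly) :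
    (aeval L p).det = 0 := by
  let φ : ℂ[X] →+* Fc := (algebraMap Fr Fc).comp (algebraMap ℂ[X] Fr)
  have hφ : Function.Injective φ :=
    (algebraMap Fr Fc).injective.comp (IsFractionRing.injective ℂ[X] Fr)
  have hdeg : (p.map φ).degree ≠ 0 := by
    rw [Polynomial.degree_map_eq_of_injective hφ]
    intro h0
    have := hp.natDegree_eq_zero.1 (Polynomial.natDegree_eq_of_degree_eq_some (n := 0) h0)
    exact hirr.not_isUnit (this ▸ isUnit_one)
  obtain ⟨μ, hμ⟩ := IsAlgClosed.exists_root (p.map φ) hdeg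
  have hroot : (L.map φ).charpoly.IsRoot μ := by
    rw [Matrix.charpoly_map]
    exact hμ.dvd (Polynomial.map_dvd φ hdvd)
  have hdet : (Matrix.scalar n μ - L.map φ).det = 0 := by
    rw [← Matrix.eval_charpoly]; exact hroot
  obtain ⟨v, hv0, hv⟩ := Matrix.exists_mulVec_eq_zero_iff.2 hdet
  have hLv : L.map φ *ᵥ v = μ • v := by
    rw [Matrix.sub_mulVec, sub_eq_zero] at hv
    rw [← hv]
    ext i
    simp [Matrix.mulVec_diagonal]
  have h1 : ∀ f : Fc[X], aeval (L.map φ) f *ᵥ v = f.eval μ • v := by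
    intro f
    induction f using Polynomial.induction_on' with
    | add f g hf hg => rw [map_add, Matrix.add_mulVec, hf, hg, eval_add, add_smul]
    | monomial k a =>
      induction k with
      | zero => simp [Algebra.algebraMap_eq_smul_one, Matrix.smul_mulVec]
      | succ k ih =>
        have : (monomial (k+1) a : Fc[X]) = monomial k a * X := by
          rw [Polynomial.monomial_mul_X]
        rw [this, aeval_mulVec_comp, aeval_X, hLv, Matrix.mulVec_smul, ih, eval_mul, eval_X, smul_smul,
          mul_comm]
  have h2 : (aeval L p).map φ *ᵥ v = 0 := by
    rw [aeval_map_mat, h1, hμ, zero_smul]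
  have h3 : ((aeval L p).map φ).det = 0 := Matrix.exists_mulVec_eq_zero_iff.1 ⟨v, hv0, h2⟩
  apply hφ
  rw [map_zero, ← h3]
  exact RingHom.map_det φ (aeval L p)

lemma bezout_of_irreducible {F : Type*} [Field F] (p f : F[X]) (hp : Irreducible p) (h : ¬ p ∣ f) :
    ∃ a b : F[X], a * p + b * f = 1 := (hp.coprime_iff_not_dvd).2 h

lemma aeval_indep {n : Type*} [Fintype n] [DecidableEq n] (L : Matrix n n ℂ[X])
    (p : ℂ[X][X]) (hp : p.Monic) (hirr : Irreducible p) (w : n → ℂ[X]) (hw0 : w ≠ 0)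
    (hw : aeval L p *ᵥ w = 0) (f : ℂ[X][X]) (hf : f.natDegree < p.natDegree)
    (hfw : aeval L f *ᵥ w = 0) : f = 0 := by
  by_contra hf0
  let φ : ℂ[X] →+* Fr := algebraMap ℂ[X] Fr
  have hφ : Function.Injective φ := IsFractionRing.injective ℂ[X] Fr
  have hirr' : Irreducible (p.map φ) :=
    (Polynomial.Monic.irreducible_iff_irreducible_map_fraction_map (K := Fr) hp).1 hirr
  have hndvd : ¬ p.map φ ∣ f.map φ := by
    intro hd
    have h1 := Polynomial.natDegree_le_of_dvd hd (by
      rwa [Ne, Polynomial.map_eq_zero_iff hφ])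
    rw [Polynomial.natDegree_map_eq_of_injective hφ, Polynomial.natDegree_map_eq_of_injective hφ] at h1
    omega
  obtain ⟨a, b, hab⟩ := bezout_of_irreducible _ _ hirr' hndvd
  let w' : n → Fr := φ ∘ w
  have hmap : ∀ g : ℂ[X][X], aeval L g *ᵥ w = 0 → aeval (L.map φ) (g.map φ) *ᵥ w' = 0 := by
    intro g hg
    rw [← aeval_map_mat]
    ext i
    have := RingHom.map_mulVec φ (aeval L g) w i
    rw [hg] at this
    simpa [w'] using this.symm
  have h1 : aeval (L.map φ) (a * p.map φ + b * f.map φ) *ᵥ w' = 0 := by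
    rw [map_add, Matrix.add_mulVec, aeval_mulVec_comp, aeval_mulVec_comp, hmap p hw, hmap f hfw]
    simp
  rw [hab, map_one, Matrix.one_mulVec] at h1
  apply hw0
  ext1 i
  apply hφ
  simpa [w'] using congrFun h1 i

lemma exists_herm_of_irreducible {n : Type*} [Fintype n] [DecidableEq n] (L : Matrix n n ℂ[X])
    (hL : cT L = L) (p : ℂ[X][X]) (hp : p.Monic) (hirr : Irreducible p) (hdvd : p ∣ L.charpoly) :
    ∃ M : Matrix (Fin p.natDegree) (Fin p.natDegree) ℂ[X], M.charpoly = p ∧ cT M = M := by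
  obtain ⟨w, hw0, hw⟩ := Matrix.exists_mulVec_eq_zero_iff.2 (det_aeval_eq_zero L p hp hirr hdvd)
  have hd : 0 < p.natDegree := by
    rcases Nat.eq_zero_or_pos p.natDegree with h0 | h0
    · have := (Polynomial.Monic.natDegree_eq_zero hp).1 h0
      exact absurd (this ▸ isUnit_one) hirr.not_isUnit
    · exact h0
  set d := p.natDegree with hdd
  let P : Matrix n (Fin d) ℂ[X] := fun i j => ((L ^ (j : ℕ)) *ᵥ w) i
  let K : Matrix (Fin d) (Fin d) ℂ[X] := fun k j => (X ^ ((j : ℕ) + 1) %ₘ p).coeff k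
  have hP : ∀ u : Fin d → ℂ[X],
      P *ᵥ u = aeval L (∑ j : Fin d, C (u j) * X ^ (j : ℕ)) *ᵥ w := by
    intro u
    rw [map_sum, Matrix.sum_mulVec]
    ext1 i
    rw [Finset.sum_apply]
    simp only [Matrix.mulVec, dotProduct, P]
    refine Finset.sum_congr rfl fun j _ => ?_
    have : aeval L (C (u j) * X ^ (j : ℕ)) = u j • L ^ (j : ℕ) := by
      rw [map_mul, aeval_C, map_pow, aeval_X, Algebra.smul_def]
    rw [this, Finset.sum_mul]
    refine Finset.sum_congr rfl fun k _ => ?_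
    simp; ring
  have hrec : ∀ g : ℂ[X][X], g.natDegree < d →
      (∑ j : Fin d, C (g.coeff j) * X ^ (j : ℕ)) = g := by
    intro g hg
    rw [Fin.sum_univ_eq_sum_range (fun j => C (g.coeff j) * X ^ j) d]
    exact (Polynomial.as_sum_range_C_mul_X_pow' g hg).symm
  have hmod : ∀ g : ℂ[X][X], (g %ₘ p).natDegree < d := by
    intro g
    exact Polynomial.natDegree_modByMonic_lt g hp (by rintro rfl; simp [hdd] at hd)
  have hLP : L * P = P * K := by
    refine Matrix.ext fun i j => ?_
    have h1 : (P * K) i j = (P *ᵥ (fun k : Fin d => (X ^ ((j : ℕ) + 1) %ₘ p).coeff k)) i := rfl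
    have h2 : (L * P) i j = (L *ᵥ ((L ^ (j : ℕ)) *ᵥ w)) i := rfl
    rw [h1, h2, hP, hrec _ (hmod _), Matrix.mulVec_mulVec, ← pow_succ']
    have h3 := Polynomial.modByMonic_add_div (X ^ ((j : ℕ) + 1)) p
    have h4 := congrArg (fun g => aeval L g *ᵥ w) h3
    simp only [map_add, Matrix.add_mulVec] at h4
    rw [mul_comm p, aeval_mulVec_comp, hw, Matrix.mulVec_zero, add_zero] at h4
    rw [h4, map_pow, aeval_X]
  have hinj : ∀ u : Fin d → ℂ[X], P *ᵥ u = 0 → u = 0 := by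
    intro u hu
    rw [hP] at hu
    have hdeg : (∑ j : Fin d, C (u j) * X ^ (j : ℕ)).natDegree < p.natDegree := by
      refine lt_of_le_of_lt (Polynomial.natDegree_sum_le_of_forall_le (n := d - 1) _ _ ?_) (by omega)
      intro j _
      exact (Polynomial.natDegree_C_mul_X_pow_le _ _).trans (by have := j.2; omega)
    have h0 := aeval_indep L p hp hirr w hw0 hw _ hdeg hu
    ext1 j
    have h1 := congrArg (fun g => g.coeff (j : ℕ)) h0
    simp only [Polynomial.finsetSum_coeff, Polynomial.coeff_C_mul, Polynomial.coeff_X_pow,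
      Polynomial.coeff_zero] at h1
    rw [Finset.sum_eq_single j] at h1
    · simpa using h1
    · intro b _ hb
      have : (j : ℕ) ≠ b := fun h => hb (Fin.ext h.symm)
      simp [this]
    · simp
  have hKcp : K.charpoly = p := by
    have h1 : ∀ g : ℂ[X][X], aeval L g * P = P * aeval K g := by
      intro g
      induction g using Polynomial.induction_on' with
      | add f g hf hg => rw [map_add, map_add, Matrix.add_mul, Matrix.mul_add, hf, hg]
      | monomial k a =>
        induction k with
        | zero => simp [Algebra.algebraMap_eq_smul_one]
        | succ k ih =>
          have : (monomial (k+1) a : ℂ[X][X]) = monomial k a * X := by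
            rw [Polynomial.monomial_mul_X]
          rw [this, map_mul, map_mul, aeval_X, aeval_X, Matrix.mul_assoc, hLP, ← Matrix.mul_assoc, ih,
            Matrix.mul_assoc]
    have h2 := h1 K.charpoly
    rw [Matrix.aeval_self_charpoly, Matrix.mul_zero] at h2
    have h3 : aeval L K.charpoly *ᵥ w = 0 := by
      ext1 i
      have := congrFun (congrFun h2 i) ⟨0, hd⟩
      have h5 : (aeval L K.charpoly * P) i ⟨0, hd⟩ = (aeval L K.charpoly *ᵥ ((L ^ 0) *ᵥ w)) i := rfl
      rw [h5, pow_zero, Matrix.one_mulVec] at this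
      simpa using this
    have hKm : K.charpoly.Monic := Matrix.charpoly_monic K
    have hKd : K.charpoly.natDegree = d := by rw [Matrix.charpoly_natDegree_eq_dim, Fintype.card_fin]
    have h4 : K.charpoly - p = 0 := by
      apply aeval_indep L p hp hirr w hw0 hw
      · have hlt := Polynomial.degree_sub_lt_left (p := K.charpoly) (q := p)
          (by rw [Polynomial.degree_eq_natDegree hKm.ne_zero, Polynomial.degree_eq_natDegree hp.ne_zero, hKd])
          hKm.ne_zero (by rw [hKm.leadingCoeff, hp.leadingCoeff])
        rcases eq_or_ne (K.charpoly - p) 0 with h0 | h0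
        · rw [h0]; simpa using hd
        · have := Polynomial.natDegree_lt_natDegree h0 hlt
          rw [hKd] at this
          exact this
      · rw [map_sub, Matrix.sub_mulVec, h3, hw, sub_zero]
    exact sub_eq_zero.1 h4
  let H := cT P * P
  let N := ∑ i, ∑ j, (H i j).natDegree
  have hGood : Good H K (fun _ => N) := by
    refine ⟨?_, ?_, ?_, ?_⟩
    · refine Filter.Eventually.of_forall fun y => ?_
      rw [ev_mul, ev_cT]
      exact Matrix.posSemidef_conjTranspose_mul_self _
    · refine Filter.Eventually.of_forall fun y => ?_
      have e1 : ev y L * ev y P = ev y P * ev y K := by rw [← ev_mul, hLP, ev_mul]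
      have e2 : (ev y L)ᴴ = ev y L := by rw [← ev_cT, hL]
      have e3 : (ev y K)ᴴ * (ev y P)ᴴ = (ev y P)ᴴ * ev y L := by
        rw [← Matrix.conjTranspose_mul, ← e1, Matrix.conjTranspose_mul, e2]
      rw [ev_mul, ev_cT, Matrix.mul_assoc, ← e1, ← Matrix.mul_assoc, ← Matrix.mul_assoc, e3]
    · intro h0
      obtain ⟨u, hu0, hu⟩ := Matrix.exists_mulVec_eq_zero_iff.2 h0
      apply hu0
      apply hinj
      ext1 i
      apply poly_ext
      refine Filter.Eventually.of_forall fun y => ?_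
      have h1 := ev_mulVec y H u
      rw [hu, ev_mul, ev_cT] at h1
      have h2 : ((ev y P)ᴴ * ev y P) *ᵥ (fun i => (u i).eval (y : ℂ)) = 0 := by
        rw [h1]; ext; simp
      rw [Matrix.conjTranspose_mul_self_mulVec_eq_zero, ev_mulVec] at h2
      simpa using congrFun h2 i
    · intro i j
      have h1 : (H i j).natDegree ≤ ∑ j, (H i j).natDegree :=
        Finset.single_le_sum (f := fun j => (H i j).natDegree) (fun _ _ => Nat.zero_le _) (Finset.mem_univ j)
      have h2 : ∑ j, (H i j).natDegree ≤ N :=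
        Finset.single_le_sum (f := fun i => ∑ j, (H i j).natDegree) (fun _ _ => Nat.zero_le _) (Finset.mem_univ i)
      omega
  obtain ⟨M, hM, hM'⟩ := hGood.exists_herm
  exact ⟨M, hM.trans hKcp, hM'⟩

/-- every monic factor of a Hermitian pencil's characteristic polynomial is realised -/
lemma exists_herm_of_monic {n : Type*} [Fintype n] [DecidableEq n] (L : Matrix n n ℂ[X])
    (hL : cT L = L) (N : ℕ) : ∀ (p : ℂ[X][X]), p.natDegree = N → p.Monic → p ∣ L.charpoly →
    ∃ M : Matrix (Fin p.natDegree) (Fin p.natDegree) ℂ[X], M.charpoly = p ∧ cT M = M := by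
  induction N using Nat.strong_induction_on with
  | _ N ih =>
    intro p hN hp hdvd
    by_cases hirr : Irreducible p
    · exact exists_herm_of_irreducible L hL p hp hirr hdvd
    by_cases h1 : p = 1
    · subst h1
      refine ⟨0, ?_, ?_⟩
      · have : IsEmpty (Fin (natDegree (1 : ℂ[X][X]))) := by simp; infer_instance
        simp [Matrix.charpoly]
      · refine Matrix.ext fun i j => ?_
        simp
    have hex : ∃ f g : ℂ[X][X], f.Monic ∧ g.Monic ∧ f * g = p ∧ f ≠ 1 ∧ g ≠ 1 := by
      rw [Polynomial.Monic.irreducible_iff_natDegree hp] at hirr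
      push Not at hirr
      obtain ⟨f, g, hf, hg, hfg, hf1, hg1⟩ := hirr h1
      refine ⟨f, g, hf, hg, hfg, ?_, ?_⟩
      · rintro rfl; simp at hf1
      · rintro rfl; simp at hg1
    obtain ⟨f, g, hf, hg, hfg, hf1, hg1⟩ := hex
    have hnd : f.natDegree + g.natDegree = p.natDegree := by rw [← hfg, hf.natDegree_mul hg]
    have hf0 : f.natDegree ≠ 0 := fun h => hf1 (hf.natDegree_eq_zero.1 h)
    have hg0 : g.natDegree ≠ 0 := fun h => hg1 (hg.natDegree_eq_zero.1 h)
    obtain ⟨M1, hM1, hM1'⟩ := ih f.natDegree (by omega) f rfl hf ((Dvd.intro _ hfg).trans hdvd)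
    obtain ⟨M2, hM2, hM2'⟩ := ih g.natDegree (by omega) g rfl hg ((Dvd.intro_left _ hfg).trans hdvd)
    let e : Fin f.natDegree ⊕ Fin g.natDegree ≃ Fin p.natDegree := finSumFinEquiv.trans (finCongr hnd)
    refine ⟨Matrix.reindex e e (Matrix.fromBlocks M1 0 0 M2), ?_, ?_⟩
    · rw [Matrix.charpoly_reindex, Matrix.charpoly_fromBlocks_zero₁₂, hM1, hM2, hfg]
    · have hb : cT (Matrix.fromBlocks M1 0 0 M2) = Matrix.fromBlocks M1 0 0 M2 := by
        conv_rhs => rw [← hM1', ← hM2']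
        refine Matrix.ext fun i j => ?_
        rcases i with i | i <;> rcases j with j | j <;> simp
      refine Matrix.ext fun i j => ?_
      exact congrFun (congrFun hb (e.symm i)) (e.symm j)

end HV

end

section

open Polynomial Filter
open scoped ComplexOrder

namespace HV

lemma trace_sq_eq {n : ℕ} {M N : Matrix (Fin n) (Fin n) ℂ} (hM : M.IsHermitian) (hN : N.IsHermitian)
    (h : M.charpoly = N.charpoly) : (M * M).trace = (N * N).trace := by
  have key : ∀ {M : Matrix (Fin n) (Fin n) ℂ} (hM : M.IsHermitian),
      (M * M).trace = ∑ i, ((hM.eigenvalues i : ℂ)) ^ 2 := by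
    intro M hM
    have hs := hM.spectral_theorem
    set U := hM.eigenvectorUnitary
    have hU : (star U : Matrix (Fin n) (Fin n) ℂ) * (U : Matrix (Fin n) (Fin n) ℂ) = 1 := by
      exact Unitary.coe_star_mul_self U
    rw [Unitary.conjStarAlgAut_apply] at hs
    set D := Matrix.diagonal (RCLike.ofReal ∘ hM.eigenvalues : Fin n → ℂ)
    have h2 : M * M = (U : Matrix (Fin n) (Fin n) ℂ) * (D * D) * (star U : Matrix (Fin n) (Fin n) ℂ) := by
      conv_lhs => rw [hs]
      calc _ = (U : Matrix (Fin n) (Fin n) ℂ) * D *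
            ((star U : Matrix (Fin n) (Fin n) ℂ) * (U : Matrix (Fin n) (Fin n) ℂ)) * D *
              (star U : Matrix (Fin n) (Fin n) ℂ) := by simp only [Matrix.mul_assoc]
        _ = _ := by rw [hU, Matrix.mul_one]; simp only [Matrix.mul_assoc]
    rw [h2, Matrix.trace_mul_cycle, hU, Matrix.one_mul, Matrix.diagonal_mul_diagonal, Matrix.trace_diagonal]
    simp [sq]
  rw [key hM, key hN, (hM.eigenvalues_eq_eigenvalues_iff hN).2 h]

lemma ev_charpoly {n : ℕ} (z : ℂ) (M : Matrix (Fin n) (Fin n) ℂ[X]) :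
    (ev z M).charpoly = M.charpoly.map (evalRingHom z) := by
  unfold ev
  rw [Matrix.charpoly_map]

lemma ev_herm {n : ℕ} (y : ℝ) {M : Matrix (Fin n) (Fin n) ℂ[X]} (h : cT M = M) :
    (ev y M).IsHermitian := by
  unfold Matrix.IsHermitian
  rw [← ev_cT, h]

lemma cj_coeff (f : ℂ[X]) (k : ℕ) : (cj f).coeff k = starRingEnd ℂ (f.coeff k) := by
  simp [cj]

/-- a Hermitian polynomial matrix isospectral to a linear pencil is linear -/
lemma natDegree_le_one {n : ℕ} (L L₀ : Matrix (Fin n) (Fin n) ℂ[X]) (hL : cT L = L) (hL₀ : cT L₀ = L₀)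
    (hcp : L.charpoly = L₀.charpoly) (hdeg : ∀ i j, (L₀ i j).natDegree ≤ 1) (i j : Fin n) :
    (L i j).natDegree ≤ 1 := by
  have htr : (L * L).trace = (L₀ * L₀).trace := by
    apply poly_ext
    refine Filter.Eventually.of_forall fun y => ?_
    have h1 : ∀ M : Matrix (Fin n) (Fin n) ℂ[X], (M * M).trace.eval (y : ℂ) = (ev y M * ev y M).trace := by
      intro M
      rw [← ev_mul]
      simp [Matrix.trace, Polynomial.eval_finsetSum]
    rw [h1, h1]
    apply trace_sq_eq (ev_herm y hL) (ev_herm y hL₀)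
    rw [ev_charpoly, ev_charpoly, hcp]
  by_contra hcon
  push Not at hcon
  obtain ⟨⟨i₀, j₀⟩, -, hmax⟩ := Finset.exists_max_image (Finset.univ : Finset (Fin n × Fin n))
    (fun q => (L q.1 q.2).natDegree) ⟨(i, j), Finset.mem_univ _⟩
  set D := (L i₀ j₀).natDegree with hD
  have hmax' : ∀ a b, (L a b).natDegree ≤ D := fun a b => hmax (a, b) (Finset.mem_univ _)
  have hD2 : 2 ≤ D := le_trans hcon (hmax' i j)
  have h0 : (L₀ * L₀).trace.coeff (D + D) = 0 := by
    apply Polynomial.coeff_eq_zero_of_natDegree_lt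
    refine lt_of_le_of_lt (b := 2) ?_ (by omega)
    refine Polynomial.natDegree_sum_le_of_forall_le _ _ fun a _ => ?_
    rw [Matrix.diag_apply, Matrix.mul_apply]
    refine Polynomial.natDegree_sum_le_of_forall_le _ _ fun b _ => ?_
    exact Polynomial.natDegree_mul_le.trans (add_le_add (hdeg a b) (hdeg b a))
  rw [← htr] at h0
  have h1 : (L * L).trace.coeff (D + D) = ((∑ a, ∑ b, Complex.normSq ((L a b).coeff D) : ℝ) : ℂ) := by
    rw [Matrix.trace, Polynomial.finsetSum_coeff]
    push_cast
    refine Finset.sum_congr rfl fun a _ => ?_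
    rw [Matrix.diag_apply, Matrix.mul_apply, Polynomial.finsetSum_coeff]
    refine Finset.sum_congr rfl fun b _ => ?_
    rw [Polynomial.coeff_mul_add_eq_of_natDegree_le (hmax' a b) (hmax' b a)]
    have : L b a = cj (L a b) := by
      conv_lhs => rw [← hL]
      rfl
    rw [this, cj_coeff, Complex.mul_conj]
  rw [h1] at h0
  have h2 : (∑ a, ∑ b, Complex.normSq ((L a b).coeff D)) = 0 := by exact_mod_cast h0
  have h3 := (Finset.sum_eq_zero_iff_of_nonneg (fun a _ =>
    Finset.sum_nonneg fun b _ => Complex.normSq_nonneg _)).1 h2 i₀ (Finset.mem_univ _)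
  have h4 := (Finset.sum_eq_zero_iff_of_nonneg (fun b _ => Complex.normSq_nonneg _)).1 h3 j₀
    (Finset.mem_univ _)
  have h5 : (L i₀ j₀).coeff D = 0 := Complex.normSq_eq_zero.1 h4
  have h6 : L i₀ j₀ = 0 := Polynomial.leadingCoeff_eq_zero.1 h5
  rw [hD, h6] at hD2
  simp at hD2

lemma basePoly_eq {n : ℕ} (A : Matrix (Fin n) (Fin n) ℂ) (N : Matrix (Fin n) (Fin n) ℂ[X])
    (hdeg : ∀ i j, (N i j).natDegree ≤ 1) (hre : ∀ i j, reM A i j = -(N i j).coeff 0)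
    (him : ∀ i j, imM A i j = -(N i j).coeff 1) (x y t : ℝ) (hx : x ≠ 0) :
    basePoly A x y t =
      (x : ℂ) ^ n * (N.charpoly.map (evalRingHom ((y / x : ℝ) : ℂ))).eval ((t / x : ℝ) : ℂ) := by
  have hx' : (x : ℂ) ≠ 0 := by exact_mod_cast hx
  rw [← ev_charpoly, Matrix.eval_charpoly]
  unfold basePoly
  have : ((x : ℂ) • reM A + (y : ℂ) • imM A + (t : ℂ) • (1 : Matrix (Fin n) (Fin n) ℂ)) =
      (x : ℂ) • (Matrix.scalar (Fin n) ((t / x : ℝ) : ℂ) - ev ((y / x : ℝ) : ℂ) N) := by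
    ext i j
    have hN : (N i j).eval ((y / x : ℝ) : ℂ) = (N i j).coeff 0 + (N i j).coeff 1 * ((y / x : ℝ) : ℂ) := by
      conv_lhs => rw [Polynomial.eq_X_add_C_of_natDegree_le_one (hdeg i j)]
      simp; ring
    by_cases hij : i = j
    · subst hij
      simp only [Matrix.add_apply, Matrix.smul_apply, Matrix.sub_apply, ev_apply, hN, hre, him,
        Matrix.one_apply_eq, Matrix.scalar_apply, Matrix.diagonal_apply_eq, smul_eq_mul]
      push_cast
      field_simp
      ring
    · simp only [Matrix.add_apply, Matrix.smul_apply, Matrix.sub_apply, ev_apply, hN, hre, him,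
        Matrix.one_apply_ne hij, Matrix.scalar_apply, Matrix.diagonal_apply_ne _ hij, smul_eq_mul]
      push_cast
      field_simp
      ring
  rw [this, Matrix.det_smul, Fintype.card_fin]

lemma basePoly_continuous {n : ℕ} (A : Matrix (Fin n) (Fin n) ℂ) (y t : ℝ) :
    Continuous (fun x : ℝ => basePoly A x y t) := by
  unfold basePoly
  apply Continuous.matrix_det
  fun_prop

lemma basePoly_congr {n : ℕ} (A A' : Matrix (Fin n) (Fin n) ℂ) (N N' : Matrix (Fin n) (Fin n) ℂ[X])
    (hdeg : ∀ i j, (N i j).natDegree ≤ 1) (hre : ∀ i j, reM A i j = -(N i j).coeff 0)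
    (him : ∀ i j, imM A i j = -(N i j).coeff 1)
    (hdeg' : ∀ i j, (N' i j).natDegree ≤ 1) (hre' : ∀ i j, reM A' i j = -(N' i j).coeff 0)
    (him' : ∀ i j, imM A' i j = -(N' i j).coeff 1) (hcp : N'.charpoly = N.charpoly) (x y t : ℝ) :
    basePoly A' x y t = basePoly A x y t := by
  have hd : Dense ({0}ᶜ : Set ℝ) := dense_compl_singleton 0
  have := Continuous.ext_on hd (basePoly_continuous A' y t) (basePoly_continuous A y t) (by
    intro x hx
    have hx : x ≠ 0 := hx
    simp only
    rw [basePoly_eq A N hdeg hre him x y t hx, basePoly_eq A' N' hdeg' hre' him' x y t hx, hcp])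
  exact congrFun this x

/-- dehomogenisation -/
def theta : MvPolynomial (Fin 3) ℂ →+* ℂ[X][X] :=
  MvPolynomial.eval₂Hom ((C : ℂ[X] →+* ℂ[X][X]).comp (C : ℂ →+* ℂ[X])) ![1, C X, X]

/-- restriction to the `t` axis -/
def eta : MvPolynomial (Fin 3) ℂ →+* ℂ[X] :=
  MvPolynomial.eval₂Hom (C : ℂ →+* ℂ[X]) ![0, 0, X]

lemma coeff_theta (G : MvPolynomial (Fin 3) ℂ) (d : ℕ) (hd : G.totalDegree ≤ d) :
    (theta G).coeff d = C ((eta G).coeff d) := by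
  unfold theta eta
  rw [MvPolynomial.coe_eval₂Hom, MvPolynomial.coe_eval₂Hom, MvPolynomial.eval₂_eq', MvPolynomial.eval₂_eq']
  rw [Polynomial.finsetSum_coeff, Polynomial.finsetSum_coeff, map_sum]
  refine Finset.sum_congr rfl fun m hm => ?_
  have h1 : m 0 + m 1 + m 2 ≤ d := by
    have := MvPolynomial.le_totalDegree hm
    rw [Finsupp.sum_fintype _ _ (by simp), Fin.sum_univ_three] at this
    omega
  rw [Fin.prod_univ_three, Fin.prod_univ_three]
  simp only [RingHom.comp_apply, Polynomial.coeff_C_mul, Matrix.cons_val_zero, Matrix.cons_val_one,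
    Matrix.cons_val_two, Matrix.head_cons, Matrix.tail_cons, Matrix.cons_val, one_pow, one_mul]
  rw [← C_pow, Polynomial.coeff_C_mul, Polynomial.coeff_X_pow]
  by_cases h2 : d = m 2
  · have h3 : m 0 = 0 := by omega
    have h4 : m 1 = 0 := by omega
    simp [h2, h3, h4]
  · by_cases h3 : m 0 = 0
    · by_cases h4 : m 1 = 0
      · simp [h2, h3, h4, Polynomial.coeff_X_pow]
      · simp [h2, h4]
    · simp [h2, h3]

lemma natDegree_eta_le (G : MvPolynomial (Fin 3) ℂ) : (eta G).natDegree ≤ G.totalDegree := by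
  unfold eta
  rw [MvPolynomial.coe_eval₂Hom, MvPolynomial.eval₂_eq']
  refine Polynomial.natDegree_sum_le_of_forall_le _ _ fun m hm => ?_
  have h1 : m 0 + m 1 + m 2 ≤ G.totalDegree := by
    have := MvPolynomial.le_totalDegree hm
    rw [Finsupp.sum_fintype _ _ (by simp), Fin.sum_univ_three] at this
    omega
  rw [Fin.prod_univ_three]
  simp only [Matrix.cons_val_zero, Matrix.cons_val_one, Matrix.cons_val]
  by_cases h3 : m 0 = 0
  · by_cases h4 : m 1 = 0
    · simp only [h3, h4, pow_zero, one_mul]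
      exact (Polynomial.natDegree_C_mul_X_pow_le _ _).trans (by omega)
    · simp [h4]
  · simp [h3]

/-- the linear pencil of `A` -/
def pencil {n : ℕ} (A : Matrix (Fin n) (Fin n) ℂ) : Matrix (Fin n) (Fin n) ℂ[X] :=
  fun i j => -(C (reM A i j) + C (imM A i j) * X)

lemma theta_basePolyMv {n : ℕ} (A : Matrix (Fin n) (Fin n) ℂ) :
    theta (basePolyMv A) = (pencil A).charpoly := by
  unfold basePolyMv Matrix.charpoly
  rw [RingHom.map_det]
  congr 1
  refine Matrix.ext fun i j => ?_
  by_cases hij : i = j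
  · subst hij
    simp [theta, pencil, Matrix.charmatrix_apply_eq]
    ring
  · simp [theta, pencil, Matrix.charmatrix_apply_ne _ _ _ hij, hij]

lemma eta_basePolyMv {n : ℕ} (A : Matrix (Fin n) (Fin n) ℂ) :
    eta (basePolyMv A) = X ^ n := by
  unfold basePolyMv
  rw [RingHom.map_det]
  have : eta.mapMatrix (Matrix.of fun i j =>
    MvPolynomial.C (reM A i j) * MvPolynomial.X 0 +
    MvPolynomial.C (imM A i j) * MvPolynomial.X 1 +
    MvPolynomial.C ((1 : Matrix (Fin n) (Fin n) ℂ) i j) * MvPolynomial.X 2) =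
      Matrix.diagonal (fun _ => (X : ℂ[X])) := by
    refine Matrix.ext fun i j => ?_
    by_cases hij : i = j
    · subst hij; simp [eta]
    · simp [eta, hij]
  rw [this, Matrix.det_diagonal]; simp

lemma totalDegree_basePolyMv {n : ℕ} (A : Matrix (Fin n) (Fin n) ℂ) :
    (basePolyMv A).totalDegree ≤ n := by
  unfold basePolyMv
  rw [Matrix.det_apply]
  refine MvPolynomial.totalDegree_finsetSum_le fun σ _ => ?_
  refine (MvPolynomial.totalDegree_smul_le _ _).trans ?_
  refine (MvPolynomial.totalDegree_finset_prod _ _).trans ?_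
  calc _ ≤ ∑ i : Fin n, 1 := Finset.sum_le_sum fun i _ => ?_
    _ = n := by simp
  have h : ∀ (c : ℂ) (k : Fin 3), (MvPolynomial.C c * MvPolynomial.X k : MvPolynomial (Fin 3) ℂ).totalDegree ≤ 1 := by
    intro c k
    refine (MvPolynomial.totalDegree_mul _ _).trans ?_
    simp
  simp only [Matrix.of_apply]
  exact (MvPolynomial.totalDegree_add _ _).trans (max_le ((MvPolynomial.totalDegree_add _ _).trans
    (max_le (h _ _) (h _ _))) (h _ _))

lemma natDegree_theta_pos {n : ℕ} (A : Matrix (Fin n) (Fin n) ℂ) (G H : MvPolynomial (Fin 3) ℂ)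
    (hG : 0 < G.totalDegree) (hfact : basePolyMv A = G * H) : 0 < (theta G).natDegree := by
  have h1 := eta_basePolyMv A
  rw [hfact, map_mul] at h1
  have hX : (X ^ n : ℂ[X]) ≠ 0 := pow_ne_zero _ Polynomial.X_ne_zero
  have hG0 : eta G ≠ 0 := by intro h; rw [h, zero_mul] at h1; exact hX h1.symm
  have hH0 : eta H ≠ 0 := by intro h; rw [h, mul_zero] at h1; exact hX h1.symm
  have h2 : (eta G).natDegree + (eta H).natDegree = n := by
    rw [← Polynomial.natDegree_mul hG0 hH0, h1, Polynomial.natDegree_X_pow]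
  have h3 := natDegree_eta_le G
  have h4 := natDegree_eta_le H
  have h5 := totalDegree_basePolyMv A
  have hG1 : G ≠ 0 := by rintro rfl; simp at hG
  have hH1 : H ≠ 0 := by rintro rfl; simp at hH0
  rw [hfact, MvPolynomial.totalDegree_mul_of_isDomain hG1 hH1] at h5
  have h6 : (eta G).natDegree = G.totalDegree := by omega
  have h7 := coeff_theta G G.totalDegree le_rfl
  have h8 : (theta G).coeff G.totalDegree ≠ 0 := by
    rw [h7, ← h6, Ne, Polynomial.C_eq_zero]
    exact Polynomial.leadingCoeff_ne_zero.2 hG0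
  exact lt_of_lt_of_le hG (Polynomial.le_natDegree_of_ne_zero h8)

end HV

end

section

open Polynomial Filter
open scoped ComplexOrder

namespace HV

lemma dot_self_eq {n : ℕ} (x : Fin n → ℂ) : star x ⬝ᵥ x = ((∑ i, Complex.normSq (x i) : ℝ) : ℂ) := by
  simp [dotProduct, Complex.normSq_eq_conj_mul_self]

lemma dot_self_pos {n : ℕ} {x : Fin n → ℂ} (hx : x ≠ 0) : 0 < (∑ i, Complex.normSq (x i)) := by
  obtain ⟨i, hi⟩ := Function.ne_iff.1 hx
  exact Finset.sum_pos' (fun i _ => Complex.normSq_nonneg _)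
    ⟨i, Finset.mem_univ _, Complex.normSq_pos.2 hi⟩

/-- scaling criterion for membership -/
lemma mem_numRange_of {n : ℕ} (A : Matrix (Fin n) (Fin n) ℂ) {v : Fin n → ℂ} (hv : v ≠ 0) {z : ℂ}
    (h : star v ⬝ᵥ A.mulVec v = z * (star v ⬝ᵥ v)) : z ∈ numRange A := by
  have hp := dot_self_pos hv
  set s := ∑ i, Complex.normSq (v i) with hs
  have hsq : (((Real.sqrt s)⁻¹ : ℝ) : ℂ) * (((Real.sqrt s)⁻¹ : ℝ) : ℂ) * (s : ℂ) = 1 := by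
    have : (Real.sqrt s)⁻¹ * (Real.sqrt s)⁻¹ * s = 1 := by
      rw [← mul_inv, Real.mul_self_sqrt hp.le, inv_mul_cancel₀ hp.ne']
    exact_mod_cast this
  refine ⟨(((Real.sqrt s)⁻¹ : ℝ) : ℂ) • v, ?_, ?_⟩
  · rw [star_smul, smul_dotProduct, dotProduct_smul, dot_self_eq, ← hs, smul_eq_mul, smul_eq_mul,
      ← mul_assoc, Complex.star_def, Complex.conj_ofReal, hsq]
  · rw [Matrix.mulVec_smul, star_smul, smul_dotProduct, dotProduct_smul, h, dot_self_eq, ← hs,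
      smul_eq_mul, smul_eq_mul, Complex.star_def, Complex.conj_ofReal]
    linear_combination z * hsq

lemma exists_phase (w : ℂ) : ∃ c : ℂ, star c * c = 1 ∧ (c * w).im = 0 := by
  by_cases hw : w = 0
  · exact ⟨1, by simp, by simp [hw]⟩
  · have hn : (‖w‖ : ℂ) ≠ 0 := by exact_mod_cast norm_ne_zero_iff.2 hw
    have h1 : star w * w = (‖w‖ : ℂ) * ‖w‖ := by
      rw [Complex.star_def, ← Complex.normSq_eq_conj_mul_self, Complex.normSq_eq_norm_sq]; push_cast; ring
    refine ⟨star w / ‖w‖, ?_, ?_⟩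
    · simp only [star_div₀, star_star]
      rw [Complex.star_def, Complex.conj_ofReal]
      field_simp
      rw [Complex.star_def] at h1
      linear_combination h1
    · have : star w / (‖w‖ : ℂ) * w = ((‖w‖ : ℝ) : ℂ) := by
        field_simp
        linear_combination h1
      rw [this, Complex.ofReal_im]

lemma numRange_convex {n : ℕ} (A : Matrix (Fin n) (Fin n) ℂ) : Convex ℝ (numRange A) := by
  rintro p ⟨x, hx1, hxp⟩ q ⟨y, hy1, hyq⟩ a b ha hb hab
  by_cases hpq : p = q
  · subst hpq
    rw [← add_smul, hab, one_smul]
    exact ⟨x, hx1, hxp⟩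
  have hqp : q - p ≠ 0 := sub_ne_zero.2 (Ne.symm hpq)
  set B : Matrix (Fin n) (Fin n) ℂ := (q - p)⁻¹ • (A - p • (1 : Matrix (Fin n) (Fin n) ℂ)) with hB
  have hBv : ∀ u v : Fin n → ℂ, star u ⬝ᵥ B.mulVec v =
      (q - p)⁻¹ * (star u ⬝ᵥ A.mulVec v - p * (star u ⬝ᵥ v)) := by
    intro u v
    rw [hB, Matrix.smul_mulVec, Matrix.sub_mulVec, Matrix.smul_mulVec, Matrix.one_mulVec,
      dotProduct_smul, dotProduct_sub, dotProduct_smul, smul_eq_mul, smul_eq_mul]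
  have hAv : ∀ u v : Fin n → ℂ, star u ⬝ᵥ A.mulVec v =
      (q - p) * (star u ⬝ᵥ B.mulVec v) + p * (star u ⬝ᵥ v) := by
    intro u v
    rw [hBv]; field_simp; ring
  have hBx : star x ⬝ᵥ B.mulVec x = 0 := by rw [hBv, hxp, hx1]; ring
  have hBy : star y ⬝ᵥ B.mulVec y = 1 := by rw [hBv, hyq, hy1]; field_simp
  obtain ⟨c, hc1, hc2⟩ := exists_phase (star x ⬝ᵥ B.mulVec y - star (star y ⬝ᵥ B.mulVec x))
  set k := star x ⬝ᵥ B.mulVec y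
  set l := star y ⬝ᵥ B.mulVec x
  have hc3 : (c * k + star c * l).im = 0 := by
    have e1 : (c * (k - star l)).im = (c * k + star c * l).im := by
      simp [Complex.mul_im, Complex.sub_im, Complex.add_im, Complex.star_def]
      ring
    rw [← e1, hc2]
  let v : ℝ → (Fin n → ℂ) := fun t => (((1 - t : ℝ)) : ℂ) • x + ((t : ℂ) * c) • y
  have hstar : ∀ t, star (v t) = (((1 - t : ℝ)) : ℂ) • star x + ((t : ℂ) * star c) • star y := by
    intro t
    simp only [v, star_add, star_smul, star_mul']
    simp only [Complex.star_def, Complex.conj_ofReal]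
  have hform : ∀ t, star (v t) ⬝ᵥ B.mulVec (v t) =
      ((t * t + (1 - t) * t * (c * k + star c * l).re : ℝ) : ℂ) := by
    intro t
    have hreal : c * k + star c * l = (((c * k + star c * l).re : ℝ) : ℂ) := by
      exact Complex.ext (by rw [Complex.ofReal_re]) (by rw [hc3, Complex.ofReal_im])
    rw [hstar]
    simp only [v, Matrix.mulVec_add, Matrix.mulVec_smul, add_dotProduct, dotProduct_add,
      smul_dotProduct, dotProduct_smul, smul_eq_mul, hBx, hBy]
    change _ * (_ * (0:ℂ) + _ * l) + _ * (_ * k + _) = _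
    push_cast
    rw [← hreal]
    linear_combination (t : ℂ) * t * hc1
  have hne : ∀ t ∈ Set.Icc (0:ℝ) 1, v t ≠ 0 := by
    intro t ht h0
    have e : (((1 - t : ℝ)) : ℂ) • x = -(((t : ℂ) * c) • y) := eq_neg_of_add_eq_zero_left h0
    have e1 : star ((((1 - t : ℝ)) : ℂ) • x) ⬝ᵥ B.mulVec ((((1 - t : ℝ)) : ℂ) • x) = 0 := by
      rw [star_smul, Matrix.mulVec_smul, smul_dotProduct, dotProduct_smul, hBx]; simp
    rw [e, star_neg, Matrix.mulVec_neg, neg_dotProduct, dotProduct_neg, neg_neg, star_smul,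
      Matrix.mulVec_smul, smul_dotProduct, dotProduct_smul, hBy, smul_eq_mul, smul_eq_mul, star_mul',
      Complex.star_def, Complex.conj_ofReal] at e1
    have e2 : (t : ℂ) * t = 0 := by
      rw [Complex.star_def] at hc1
      linear_combination e1 - (t : ℂ) * t * hc1
    have ht0 : t = 0 := by
      have : (t : ℂ) = 0 := by simpa using e2
      exact_mod_cast this
    subst ht0
    have hx0 : x = 0 := by simpa [v] using h0
    rw [hx0] at hx1
    simp at hx1
  let N : ℝ → ℝ := fun t => ∑ i, Complex.normSq (v t i)
  have hNpos : ∀ t ∈ Set.Icc (0:ℝ) 1, 0 < N t := fun t ht => dot_self_pos (hne t ht)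
  have hNc : Continuous N := by
    simp only [N, v, Complex.normSq_apply]
    fun_prop
  let r := (c * k + star c * l).re
  have hφ : ContinuousOn (fun t : ℝ => (t * t + (1 - t) * t * r) / N t) (Set.Icc 0 1) := by
    apply ContinuousOn.div
    · fun_prop
    · exact hNc.continuousOn
    · intro t ht; exact (hNpos t ht).ne'
  have hN1 : N 1 = 1 := by
    have h1 := dot_self_eq (v 1)
    have h2 : star (v 1) ⬝ᵥ v 1 = 1 := by
      rw [hstar]
      simp only [v, add_dotProduct, dotProduct_add,
        smul_dotProduct, dotProduct_smul, smul_eq_mul, hx1, hy1]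
      push_cast
      linear_combination hc1
    rw [h2] at h1
    exact_mod_cast h1.symm
  have hivt := intermediate_value_Icc (zero_le_one' ℝ) hφ
  have hb1 : b ∈ Set.Icc ((fun t : ℝ => (t * t + (1 - t) * t * r) / N t) 0)
      ((fun t : ℝ => (t * t + (1 - t) * t * r) / N t) 1) := by
    simp only [hN1]
    constructor
    · simpa using hb
    · norm_num; linarith
  obtain ⟨t, ht, hbt⟩ := hivt hb1
  apply mem_numRange_of A (hne t ht)
  rw [hAv, hform, dot_self_eq]
  have hbt' : t * t + (1 - t) * t * r = b * N t := by
    rw [← hbt]; field_simp [(hNpos t ht).ne']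
  change (q - p) * ((t * t + (1 - t) * t * r : ℝ) : ℂ) + p * ((N t : ℝ) : ℂ) = _ * ((N t : ℝ) : ℂ)
  rw [hbt']
  have ha' : a = 1 - b := by linarith
  rw [ha', Complex.real_smul, Complex.real_smul]
  push_cast
  ring

lemma numRange_compact {n : ℕ} (A : Matrix (Fin n) (Fin n) ℂ) : IsCompact (numRange A) := by
  have hK : IsCompact {x : Fin n → ℂ | star x ⬝ᵥ x = 1} := by
    apply Metric.isCompact_of_isClosed_isBounded
    · exact isClosed_eq (by fun_prop) continuous_const
    · refine (Metric.isBounded_closedBall (x := (0 : Fin n → ℂ)) (r := 1)).subset fun x hx => ?_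
      rw [mem_closedBall_zero_iff, pi_norm_le_iff_of_nonneg zero_le_one]
      intro i
      have h1 : star x ⬝ᵥ x = 1 := hx
      rw [dot_self_eq] at h1
      have h2 : (∑ i, Complex.normSq (x i)) = 1 := by exact_mod_cast h1
      have h3 : Complex.normSq (x i) ≤ 1 := by
        rw [← h2]
        exact Finset.single_le_sum (f := fun i => Complex.normSq (x i))
          (fun i _ => Complex.normSq_nonneg _) (Finset.mem_univ i)
      rw [Complex.normSq_eq_norm_sq] at h3
      nlinarith [norm_nonneg (x i)]
  have : numRange A = (fun x : Fin n → ℂ => star x ⬝ᵥ A.mulVec x) '' {x | star x ⬝ᵥ x = 1} := rfl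
  rw [this]
  apply hK.image
  fun_prop

lemma reM_herm {n : ℕ} (A : Matrix (Fin n) (Fin n) ℂ) : (reM A).IsHermitian := by
  unfold reM Matrix.IsHermitian
  ext i j
  simp
  ring

lemma imM_herm {n : ℕ} (A : Matrix (Fin n) (Fin n) ℂ) : (imM A).IsHermitian := by
  unfold imM Matrix.IsHermitian
  ext i j
  simp
  ring

lemma re_add_im {n : ℕ} (A : Matrix (Fin n) (Fin n) ℂ) : A = reM A + Complex.I • imM A := by
  unfold reM imM
  ext i j
  simp
  field_simp
  rw [Complex.I_sq]
  ring

lemma herm_form_im {n : ℕ} {P : Matrix (Fin n) (Fin n) ℂ} (hP : P.IsHermitian) (x : Fin n → ℂ) :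
    (star x ⬝ᵥ P.mulVec x).im = 0 := by
  have := hP.im_star_dotProduct_mulVec_self x
  simpa using this

/-- test matrix -/
def testM {n : ℕ} (A : Matrix (Fin n) (Fin n) ℂ) (a b u : ℝ) : Matrix (Fin n) (Fin n) ℂ :=
  (u : ℂ) • (1 : Matrix (Fin n) (Fin n) ℂ) - (a : ℂ) • reM A - (b : ℂ) • imM A

lemma testM_herm {n : ℕ} (A : Matrix (Fin n) (Fin n) ℂ) (a b u : ℝ) : (testM A a b u).IsHermitian := by
  have h1 := reM_herm A
  have h2 := imM_herm A
  unfold Matrix.IsHermitian at *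
  unfold testM
  simp [Matrix.conjTranspose_sub, Matrix.conjTranspose_smul, h1, h2]

lemma testM_form {n : ℕ} (A : Matrix (Fin n) (Fin n) ℂ) (a b u : ℝ) (x : Fin n → ℂ) :
    star x ⬝ᵥ (testM A a b u).mulVec x =
      ((u * (∑ i, Complex.normSq (x i)) - a * (star x ⬝ᵥ A.mulVec x).re
        - b * (star x ⬝ᵥ A.mulVec x).im : ℝ) : ℂ) := by
  have h1 := herm_form_im (reM_herm A) x
  have h2 := herm_form_im (imM_herm A) x
  have h3 : star x ⬝ᵥ A.mulVec x = star x ⬝ᵥ (reM A).mulVec x + Complex.I * (star x ⬝ᵥ (imM A).mulVec x) := by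
    conv_lhs => rw [re_add_im A]
    rw [Matrix.add_mulVec, Matrix.smul_mulVec, dotProduct_add, dotProduct_smul, smul_eq_mul]
  have hr : (star x ⬝ᵥ A.mulVec x).re = (star x ⬝ᵥ (reM A).mulVec x).re := by
    rw [h3]; simp [h2]
  have hi : (star x ⬝ᵥ A.mulVec x).im = (star x ⬝ᵥ (imM A).mulVec x).re := by
    rw [h3]; simp [h1]
  rw [hr, hi]
  unfold testM
  rw [Matrix.sub_mulVec, Matrix.sub_mulVec, Matrix.smul_mulVec, Matrix.smul_mulVec, Matrix.smul_mulVec,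
    Matrix.one_mulVec, dotProduct_sub, dotProduct_sub, dotProduct_smul, dotProduct_smul, dotProduct_smul,
    dot_self_eq]
  have e1 : star x ⬝ᵥ (reM A).mulVec x = (((star x ⬝ᵥ (reM A).mulVec x).re : ℝ) : ℂ) := by
    apply Complex.ext <;> simp [h1]
  have e2 : star x ⬝ᵥ (imM A).mulVec x = (((star x ⬝ᵥ (imM A).mulVec x).re : ℝ) : ℂ) := by
    apply Complex.ext <;> simp [h2]
  rw [e1, e2]
  simp only [smul_eq_mul, Complex.ofReal_re]
  push_cast
  ring

lemma testM_charpoly {n : ℕ} (A A' : Matrix (Fin n) (Fin n) ℂ)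
    (h : ∀ x y t : ℝ, basePoly A' x y t = basePoly A x y t) (a b u : ℝ) :
    (testM A' a b u).charpoly = (testM A a b u).charpoly := by
  apply poly_ext
  refine Filter.Eventually.of_forall fun t => ?_
  have key : ∀ A : Matrix (Fin n) (Fin n) ℂ, (testM A a b u).charpoly.eval (t : ℂ) = basePoly A a b (t - u) := by
    intro A
    rw [Matrix.eval_charpoly]
    unfold basePoly testM
    congr 1
    rw [Matrix.scalar_apply, ← Matrix.smul_one_eq_diagonal]
    push_cast
    rw [sub_smul]
    abel
  rw [key, key, h]

lemma numRange_subset {n : ℕ} (A A' : Matrix (Fin n) (Fin n) ℂ)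
    (h : ∀ x y t : ℝ, basePoly A' x y t = basePoly A x y t) : numRange A' ⊆ numRange A := by
  intro z hz
  by_contra hzA
  obtain ⟨f, u, hf1, hf2⟩ := geometric_hahn_banach_closed_point (numRange_convex A)
    (numRange_compact A).isClosed hzA
  have hfw : ∀ w : ℂ, f w = f 1 * w.re + f Complex.I * w.im := by
    intro w
    have : w = w.re • (1 : ℂ) + w.im • Complex.I := by
      apply Complex.ext <;> simp
    conv_lhs => rw [this]
    rw [map_add, map_smul, map_smul, smul_eq_mul, smul_eq_mul]
    ring
  set a := f 1
  set b := f Complex.I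
  have hP : (testM A a b u).PosSemidef := by
    rw [Matrix.posSemidef_iff_dotProduct_mulVec]
    refine ⟨testM_herm A a b u, fun x => ?_⟩
    rw [testM_form]
    rw [Complex.zero_le_real]
    by_cases hx : x = 0
    · subst hx; simp
    have hp := dot_self_pos hx
    set s := ∑ i, Complex.normSq (x i) with hs
    have hmem : (star x ⬝ᵥ A.mulVec x) / (s : ℂ) ∈ numRange A := by
      apply mem_numRange_of A hx
      rw [dot_self_eq, ← hs, div_mul_cancel₀]
      exact_mod_cast hp.ne'
    have h1 := hf1 _ hmem
    rw [hfw, Complex.div_ofReal_re, Complex.div_ofReal_im] at h1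
    have h2 : (a * (star x ⬝ᵥ A.mulVec x).re + b * (star x ⬝ᵥ A.mulVec x).im) / s < u := by
      convert h1 using 1; ring
    rw [div_lt_iff₀ hp] at h2
    linarith
  have hP' : (testM A' a b u).PosSemidef := by
    rw [(testM_herm A' a b u).posSemidef_iff_eigenvalues_nonneg,
      ((testM_herm A' a b u).eigenvalues_eq_eigenvalues_iff (testM_herm A a b u)).2
        (testM_charpoly A A' h a b u)]
    exact (testM_herm A a b u).posSemidef_iff_eigenvalues_nonneg.1 hP
  obtain ⟨x, hx1, hx2⟩ := hz
  have h1 := (Matrix.posSemidef_iff_dotProduct_mulVec.1 hP').2 x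
  rw [testM_form, hx2, Complex.zero_le_real] at h1
  rw [dot_self_eq] at hx1
  have h2 : (∑ i, Complex.normSq (x i)) = 1 := by exact_mod_cast hx1
  rw [h2] at h1
  rw [hfw] at hf2
  linarith

end HV

end

section

open Polynomial Filter
open scoped ComplexOrder

namespace HV

lemma pencil_cT {n : ℕ} (A : Matrix (Fin n) (Fin n) ℂ) : cT (pencil A) = pencil A := by
  ext i j k
  rw [cT_apply, cj_coeff]
  have h1 : star (reM A j i) = reM A i j := congrFun (congrFun (reM_herm A) i) j
  have h2 : star (imM A j i) = imM A i j := congrFun (congrFun (imM_herm A) i) j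
  unfold pencil
  rw [← h1, ← h2]
  simp only [Polynomial.coeff_neg, Polynomial.coeff_add, Polynomial.coeff_C_mul, Polynomial.coeff_C,
    Polynomial.coeff_X, map_neg, map_add, map_mul, Complex.star_def]
  split_ifs <;> simp

lemma pencil_natDegree {n : ℕ} (A : Matrix (Fin n) (Fin n) ℂ) (i j : Fin n) :
    (pencil A i j).natDegree ≤ 1 := by
  unfold pencil
  rw [Polynomial.natDegree_neg, add_comm]
  exact Polynomial.natDegree_linear_le

lemma pencil_coeff_zero {n : ℕ} (A : Matrix (Fin n) (Fin n) ℂ) (i j : Fin n) :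
    reM A i j = -(pencil A i j).coeff 0 := by
  simp [pencil]

lemma pencil_coeff_one {n : ℕ} (A : Matrix (Fin n) (Fin n) ℂ) (i j : Fin n) :
    imM A i j = -(pencil A i j).coeff 1 := by
  simp [pencil, Polynomial.coeff_C]

/-- the complex matrix with a given linear Hermitian pencil -/
def unpencil {m : Type*} (M : Matrix m m ℂ[X]) : Matrix m m ℂ :=
  fun i j => -((M i j).coeff 0 + Complex.I * (M i j).coeff 1)

lemma unpencil_re {n : ℕ} (M : Matrix (Fin n) (Fin n) ℂ[X]) (hM : cT M = M) (i j : Fin n) :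
    reM (unpencil M) i j = -(M i j).coeff 0 := by
  have h : ∀ k, star ((M j i).coeff k) = (M i j).coeff k := by
    intro k
    conv_rhs => rw [← hM, cT_apply, cj_coeff]
    rfl
  simp only [reM, unpencil, Matrix.smul_apply, Matrix.add_apply, Matrix.conjTranspose_apply, star_neg,
    star_add, star_mul', h, smul_eq_mul]
  simp only [Complex.star_def, Complex.conj_I]
  ring

lemma unpencil_im {n : ℕ} (M : Matrix (Fin n) (Fin n) ℂ[X]) (hM : cT M = M) (i j : Fin n) :
    imM (unpencil M) i j = -(M i j).coeff 1 := by
  have h : ∀ k, star ((M j i).coeff k) = (M i j).coeff k := by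
    intro k
    conv_rhs => rw [← hM, cT_apply, cj_coeff]
    rfl
  simp only [imM, unpencil, Matrix.smul_apply, Matrix.sub_apply, Matrix.conjTranspose_apply, star_neg,
    star_add, star_mul', h, smul_eq_mul]
  simp only [Complex.star_def, Complex.conj_I]
  have hI : Complex.I ≠ 0 := Complex.I_ne_zero
  field_simp
  ring

lemma assemble {n a b : ℕ} (A : Matrix (Fin n) (Fin n) ℂ) (e : Fin a ⊕ Fin b ≃ Fin n)
    (M₁ : Matrix (Fin a) (Fin a) ℂ[X]) (M₂ : Matrix (Fin b) (Fin b) ℂ[X])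
    (h₁ : cT M₁ = M₁) (h₂ : cT M₂ = M₂) (hcp : M₁.charpoly * M₂.charpoly = (pencil A).charpoly) :
    (∀ x y t : ℝ, basePoly (Matrix.reindex e e (Matrix.fromBlocks (unpencil M₁) 0 0 (unpencil M₂))) x y t
      = basePoly A x y t) ∧
    numRange (Matrix.reindex e e (Matrix.fromBlocks (unpencil M₁) 0 0 (unpencil M₂))) = numRange A := by
  set M : Matrix (Fin n) (Fin n) ℂ[X] := Matrix.reindex e e (Matrix.fromBlocks M₁ 0 0 M₂) with hMdef
  have hA' : Matrix.reindex e e (Matrix.fromBlocks (unpencil M₁) 0 0 (unpencil M₂)) = unpencil M := by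
    ext i j
    simp only [hMdef, Matrix.reindex_apply, Matrix.submatrix_apply, unpencil]
    rcases e.symm i with i' | i' <;> rcases e.symm j with j' | j' <;> simp [unpencil]
  have hM : cT M = M := by
    ext1 i j
    rw [cT_apply]
    simp only [hMdef, Matrix.reindex_apply, Matrix.submatrix_apply]
    rcases e.symm i with i' | i' <;> rcases e.symm j with j' | j'
    · simp only [Matrix.fromBlocks_apply₁₁]; rw [← cT_apply, h₁]
    · simp [cj]
    · simp [cj]
    · simp only [Matrix.fromBlocks_apply₂₂]; rw [← cT_apply, h₂]
  have hMcp : M.charpoly = (pencil A).charpoly := by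
    rw [hMdef, Matrix.charpoly_reindex, Matrix.charpoly_fromBlocks_zero₁₂, hcp]
  have hdeg := natDegree_le_one M (pencil A) hM (pencil_cT A) hMcp (pencil_natDegree A)
  rw [hA']
  have hbp : ∀ x y t : ℝ, basePoly (unpencil M) x y t = basePoly A x y t :=
    basePoly_congr A (unpencil M) (pencil A) M (pencil_natDegree A) (pencil_coeff_zero A)
      (pencil_coeff_one A) hdeg (unpencil_re M hM) (unpencil_im M hM) hMcp
  exact ⟨hbp, Set.Subset.antisymm (numRange_subset A _ hbp)
    (numRange_subset _ A fun x y t => (hbp x y t).symm)⟩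

lemma exists_herm_of_monic' {n : ℕ} (L : Matrix (Fin n) (Fin n) ℂ[X]) (hL : cT L = L) (p : ℂ[X][X]) (N : ℕ)
    (hN : p.natDegree = N) (hp : p.Monic) (hd : p ∣ L.charpoly) :
    ∃ M : Matrix (Fin N) (Fin N) ℂ[X], M.charpoly = p ∧ cT M = M := by
  subst hN
  exact exists_herm_of_monic L hL _ p rfl hp hd

end HV

end

/-- If `A` is unitarily irreducible but its base polynomial factors as a product of two
nonconstant real polynomials, then there is a block-diagonal matrix `A' = B ⊕ C`
(with blocks of sizes `d` and `n - d`, `1 ≤ d ≤ n - 1`) having the same base polynomial and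
the same numerical range as `A`. -/
theorem exists_blockDiagonal_of_reducible_basePoly {n : ℕ} (A : Matrix (Fin n) (Fin n) ℂ)
    (hirr : UnitarilyIrreducible A)
    (G H : MvPolynomial (Fin 3) ℝ)
    (hG : 0 < G.totalDegree) (hH : 0 < H.totalDegree)
    (hfact : basePolyMv A =
      MvPolynomial.map (algebraMap ℝ ℂ) G * MvPolynomial.map (algebraMap ℝ ℂ) H) :
    ∃ (d : ℕ) (hd1 : 1 ≤ d) (hd2 : d ≤ n - 1)
      (B : Matrix (Fin d) (Fin d) ℂ) (C : Matrix (Fin (n - d)) (Fin (n - d)) ℂ)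
      (A' : Matrix (Fin n) (Fin n) ℂ),
      A' = Matrix.reindex (finSumFinEquiv.trans (finCongr (by omega)))
            (finSumFinEquiv.trans (finCongr (by omega)))
            (Matrix.fromBlocks B 0 0 C) ∧
      (∀ x y t : ℝ, basePoly A' x y t = basePoly A x y t) ∧
      numRange A' = numRange A := by
  have hinj : Function.Injective (algebraMap ℝ ℂ) := (algebraMap ℝ ℂ).injective
  set Gc := MvPolynomial.map (algebraMap ℝ ℂ) G with hGc
  set Hc := MvPolynomial.map (algebraMap ℝ ℂ) H with hHc
  have hG' : 0 < Gc.totalDegree := by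
    rw [hGc, MvPolynomial.totalDegree, MvPolynomial.support_map_of_injective _ hinj]; exact hG
  have hH' : 0 < Hc.totalDegree := by
    rw [hHc, MvPolynomial.totalDegree, MvPolynomial.support_map_of_injective _ hinj]; exact hH
  have hf0 := HV.natDegree_theta_pos A Gc Hc hG' hfact
  have hh0 := HV.natDegree_theta_pos A Hc Gc hH' (by rw [hfact, mul_comm])
  have hprod : HV.theta Gc * HV.theta Hc = (HV.pencil A).charpoly := by
    rw [← map_mul, ← hfact, HV.theta_basePolyMv]
  set f := HV.theta Gc
  set h := HV.theta Hc
  have hlc : f.leadingCoeff * h.leadingCoeff = 1 := by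
    rw [← Polynomial.leadingCoeff_mul, hprod]
    exact (Matrix.charpoly_monic _)
  have hlf : f.leadingCoeff ≠ 0 := left_ne_zero_of_mul_eq_one hlc
  have hlh : h.leadingCoeff ≠ 0 := right_ne_zero_of_mul_eq_one hlc
  have hf : f ≠ 0 := Polynomial.leadingCoeff_ne_zero.1 hlf
  have hh : h ≠ 0 := Polynomial.leadingCoeff_ne_zero.1 hlh
  have hsum : f.natDegree + h.natDegree = n := by
    rw [← Polynomial.natDegree_mul hf hh, hprod, Matrix.charpoly_natDegree_eq_dim, Fintype.card_fin]
  have hm1 : (Polynomial.C h.leadingCoeff * f).Monic := by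
    rw [Polynomial.Monic, Polynomial.leadingCoeff_mul, Polynomial.leadingCoeff_C, mul_comm, hlc]
  have hm2 : (Polynomial.C f.leadingCoeff * h).Monic := by
    rw [Polynomial.Monic, Polynomial.leadingCoeff_mul, Polynomial.leadingCoeff_C, hlc]
  have hp2 : (Polynomial.C h.leadingCoeff * f) * (Polynomial.C f.leadingCoeff * h)
      = (HV.pencil A).charpoly := by
    rw [← hprod]
    have : Polynomial.C f.leadingCoeff * Polynomial.C h.leadingCoeff = 1 := by
      rw [← Polynomial.C_mul, hlc, Polynomial.C_1]
    linear_combination f * h * this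
  obtain ⟨M₁, hM₁, hc₁⟩ := HV.exists_herm_of_monic' (HV.pencil A) (HV.pencil_cT A) _ f.natDegree
    (Polynomial.natDegree_C_mul hlh) hm1 (hp2 ▸ dvd_mul_right _ _)
  obtain ⟨M₂, hM₂, hc₂⟩ := HV.exists_herm_of_monic' (HV.pencil A) (HV.pencil_cT A) _ (n - f.natDegree)
    ((Polynomial.natDegree_C_mul hlf).trans (by omega)) hm2 (hp2 ▸ dvd_mul_left _ _)
  refine ⟨f.natDegree, hf0, by omega, HV.unpencil M₁, HV.unpencil M₂, _, rfl, ?_⟩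
  exact HV.assemble A _ M₁ M₂ hc₁ hc₂ (by rw [hM₁, hM₂, hp2])
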